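/- There exist universal constants C₁, C₂ > 0 such that the following holds. Let X be a nonempty finite set and D a probability distribution on X. Let H be a class of hypotheses h : X → {0,1}, let f* ∈ H, and let err(h) = Pr_{x∼D}[h(x) ≠ f*(x)]. Let χ : H × X → {0,1} be a compatibility function; write χ(h,D) = E_{x∼D}[χ(h,x)] and, for a finite sample S = (x_1,…,x_{m_u}), χ̂(h,S) = (1/m_u) Σ_{i=1}^{m_u} χ(h,x_i). Assume χ(f*, D) = 1 − t for some t ∈ [0,1], and that the family {{x ∈ X : χ(h,x) = 1} : h ∈ H} has finite VC dimension d. Let ε, δ ∈ (0,1) with t + 2ε ≤ 1. Let the unlabeled sample S = (x_1,…,x_{m_u}) be drawn from a random vector X^{(m_u)} on X^{m_u} whose probability mass function is strictly positive, whose coordinates each have marginal distribution D, and whose log-coefficient α := α_log(X^{(m_u)}) < 1/2; independently, let the labeled sample ((x'_1, f*(x'_1)),…,(x'_{m_l}, f*(x'_{m_l}))) be drawn with x'_1,…,x'_{m_l} i.i.d. from D. If m_u ≥ max( C₁ · log(2/δ) / ((1−α) ε²), C₂ · d / ((1−2α) ε²) ) and m_l ≥ (2/ε) · ( ln( 2 ·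 H_{D,χ}(t+2ε)[2 m_l, D] ) + ln(4/δ) ), then with probability at least 1 − δ: letting H₀ = { h ∈ H : h(x'_i) = f*(x'_i) for all i = 1,…,m_l }, every ĥ ∈ H₀ attaining the maximum of χ̂(·, S) over H₀ satisfies err(ĥ) ≤ ε. -/

import Mathlib

open Classical
noncomputable section

/-- The configuration obtained from `z` by replacing the `i`-th coordinate with `a`
and the `j`-th coordinate with `b`. -/
def updTwo {Z : Type*} {m : ℕ} (z : Fin m → Z) (i : Fin m) (a : Z) (j : Fin m) (b : Z) :
    Fin m → Z :=
  Function.update (Function.update z i a) j b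

/-- The log-influence `I^log_{j,i}` between coordinates `j` and `i` of a random vector on
`𝒵^m` with probability mass function `p`:  `(1/4)` times the supremum, over configurations of
the remaining coordinates and over values `zi zi' zj zj' ∈ 𝒵`, of
`log (p(zi,zj,rest) p(zi',zj',rest) / (p(zi',zj,rest) p(zi,zj',rest)))`. -/
def logInfluence {Z : Type*} [Fintype Z] {m : ℕ} (p : (Fin m → Z) → ℝ) (i j : Fin m) : ℝ :=
  (1 / 4) * ⨆ w : (Fin m → Z) × Z × Z × Z × Z,
    Real.log (p (updTwo w.1 i w.2.1 j w.2.2.1) * p (updTwo w.1 i w.2.2.2.1 j w.2.2.2.2) /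
      (p (updTwo w.1 i w.2.2.2.1 j w.2.2.1) * p (updTwo w.1 i w.2.1 j w.2.2.2.2)))

/-- The log-coefficient `α_log` of a random vector on `𝒵^m` with probability mass function `p`:
the maximum over `i` of `∑_{j ≠ i} I^log_{j,i}`. -/
def logCoefficient {Z : Type*} [Fintype Z] {m : ℕ} (p : (Fin m → Z) → ℝ) : ℝ :=
  ⨆ i : Fin m, ∑ j ∈ Finset.univ.erase i, logInfluence p i j

/-- A family `A` of subsets of `X` shatters a finite set `F` if every subset of `F` is the
intersection of `F` with some member of `A`. -/
def ShattersFamily {X : Type*} (A : Set (Set X)) (F : Finset X) : Prop :=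
  ∀ s ⊆ (F : Set X), ∃ a ∈ A, s = (F : Set X) ∩ a

/-- The VC dimension of a family of subsets of a finite set `X`: the largest cardinality of a
finite subset of `X` shattered by the family. -/
def vcDim {X : Type*} [Fintype X] (A : Set (Set X)) : ℕ :=
  Finset.univ.sup fun F : Finset X => if ShattersFamily A F then F.card else 0

/-- The expected number of splits `H'[n, D]` of `n` i.i.d. points drawn from the distribution
`D` on the finite set `X` by the hypothesis class `H'`: the expectation of the cardinality of
the set of label vectors `{(h(x₁),…,h(xₙ)) : h ∈ H'}`. -/
def expectedSplits {X : Type*} [Fintype X] (D : X → ℝ) (H' : Set (X → Bool)) (n : ℕ) : ℝ :=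
  ∑ x : Fin n → X, (∏ i, D (x i)) *
    (Set.ncard {v : Fin n → Bool | ∃ h ∈ H', v = fun i => h (x i)} : ℝ)

/-- The conditional expectation of `f` given all coordinates but the `i`-th, under the
(unnormalised) weights `p`. -/
def resample {Z : Type*} [Fintype Z] {m : ℕ} (p : (Fin m → Z) → ℝ) (i : Fin m)
    (f : (Fin m → Z) → ℝ) (x : Fin m → Z) : ℝ :=
  (∑ b, p (Function.update x i b) * f (Function.update x i b)) /
    ∑ b, p (Function.update x i b)

/-- One step of the random-scan Glauber dynamics with stationary weights `p`. -/
def glauber {Z : Type*} [Fintype Z] {m : ℕ} (p : (Fin m → Z) → ℝ)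
    (f : (Fin m → Z) → ℝ) (x : Fin m → Z) : ℝ :=
  (m : ℝ)⁻¹ * ∑ i, resample p i f x

theorem sum_update_swap {Z : Type*} [Fintype Z] {m : ℕ} (i : Fin m)
    (G : (Fin m → Z) → (Fin m → Z) → ℝ) :
    ∑ x, ∑ b, G x (Function.update x i b) = ∑ x, ∑ b, G (Function.update x i b) x := by
  rw [← Fintype.sum_prod_type', ← Fintype.sum_prod_type']
  refine Fintype.sum_equiv
    ⟨fun q => (Function.update q.1 i q.2, q.1 i), fun q => (Function.update q.1 i q.2, q.1 i),
      fun q => by simp, fun q => by simp⟩ _ _ fun q => by simp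

theorem sum_update_pos {Z : Type*} [Fintype Z] {m : ℕ} {p : (Fin m → Z) → ℝ}
    (hp : ∀ z, 0 < p z) (i : Fin m) (x : Fin m → Z) : 0 < ∑ b, p (Function.update x i b) :=
  Finset.sum_pos (fun _ _ => hp _) ⟨x i, Finset.mem_univ _⟩

theorem sub_resample_eq {Z : Type*} [Fintype Z] {m : ℕ} {p : (Fin m → Z) → ℝ}
    (hp : ∀ z, 0 < p z) (i : Fin m) (u : (Fin m → Z) → ℝ) (x : Fin m → Z) :
    p x * (u x - resample p i u x) =
      ∑ b, p x * p (Function.update x i b) / (∑ b, p (Function.update x i b)) *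
        (u x - u (Function.update x i b)) := by
  have hs := (sum_update_pos hp i x).ne'
  have h : ∀ b, p x * p (Function.update x i b) / (∑ b, p (Function.update x i b)) *
        (u x - u (Function.update x i b)) =
      (p x / (∑ b, p (Function.update x i b))) * (p (Function.update x i b) * u x -
        p (Function.update x i b) * u (Function.update x i b)) := fun b => by ring
  rw [Finset.sum_congr rfl fun b _ => h b, ← Finset.mul_sum, Finset.sum_sub_distrib,
    ← Finset.sum_mul, resample]
  field_simp

theorem sum_sub_resample_mul {Z : Type*} [Fintype Z] {m : ℕ} {p : (Fin m → Z) → ℝ}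
    (hp : ∀ z, 0 < p z) (i : Fin m) (u v : (Fin m → Z) → ℝ) :
    ∑ x, p x * (u x - resample p i u x) * v x =
      (1 / 2) * ∑ x, ∑ b, p x * p (Function.update x i b) /
        (∑ b, p (Function.update x i b)) *
        ((u x - u (Function.update x i b)) * (v x - v (Function.update x i b))) := by
  have h1 : ∑ x, p x * (u x - resample p i u x) * v x =
      ∑ x, ∑ b, (fun x y => p x * p y / (∑ b, p (Function.update x i b)) *
        (u x - u y) * v x) x (Function.update x i b) := by
    refine Finset.sum_congr rfl fun x _ => ?_
    rw [sub_resample_eq hp, Finset.sum_mul]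
  have h2 := h1.trans (sum_update_swap i fun x y =>
    p x * p y / (∑ b, p (Function.update x i b)) * (u x - u y) * v x)
  have h3 : ∀ A B S : ℝ, S = A → S = B → S = 1 / 2 * (A + B) := fun A B S h h' => by
    linarith
  rw [h3 _ _ _ h1 h2, ← Finset.sum_add_distrib]
  congr 1
  refine Finset.sum_congr rfl fun x _ => ?_
  rw [← Finset.sum_add_distrib]
  refine Finset.sum_congr rfl fun b _ => ?_
  simp only [Function.update_idem]
  ring

theorem sum_resample {Z : Type*} [Fintype Z] {m : ℕ} {p : (Fin m → Z) → ℝ}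
    (hp : ∀ z, 0 < p z) (i : Fin m) (u : (Fin m → Z) → ℝ) :
    ∑ x, p x * resample p i u x = ∑ x, p x * u x := by
  have h := sum_sub_resample_mul hp i u (fun _ => 1)
  simp only [sub_self, mul_zero, Finset.sum_const_zero, mul_one, mul_sub,
    Finset.sum_sub_distrib] at h
  linarith

theorem sum_glauber {Z : Type*} [Fintype Z] {m : ℕ} (hm : 0 < m) {p : (Fin m → Z) → ℝ}
    (hp : ∀ z, 0 < p z) (u : (Fin m → Z) → ℝ) :
    ∑ x, p x * glauber p u x = ∑ x, p x * u x := by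
  have hm' : (m : ℝ) ≠ 0 := by positivity
  simp only [glauber, Finset.mul_sum]
  rw [Finset.sum_comm]
  have : ∀ i : Fin m, ∑ x, p x * ((m : ℝ)⁻¹ * resample p i u x) =
      (m : ℝ)⁻¹ * ∑ x, p x * u x := fun i => by
    rw [← sum_resample hp i u, Finset.mul_sum]
    exact Finset.sum_congr rfl fun x _ => by ring
  simp [this, hm']

theorem abs_exp_sub_exp_le (a b : ℝ) :
    |Real.exp a - Real.exp b| ≤ |a - b| * (Real.exp a + Real.exp b) := by
  wlog h : b ≤ a generalizing a b
  · rw [abs_sub_comm, abs_sub_comm a b, add_comm]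
    exact this b a (by linarith)
  rw [abs_of_nonneg (by linarith [Real.exp_le_exp.2 h]), abs_of_nonneg (by linarith)]
  have h1 := Real.add_one_le_exp (b - a)
  have h2 : Real.exp b = Real.exp a * Real.exp (b - a) := by rw [← Real.exp_add]; ring_nf
  have h3 := Real.exp_pos a
  have h4 := Real.exp_pos b
  nlinarith [mul_nonneg (sub_nonneg.2 h) h4.le]

theorem sum_sub_resample_mul_exp_le {Z : Type*} [Fintype Z] {m : ℕ} {p : (Fin m → Z) → ℝ}
    (hp : ∀ z, 0 < p z) (i : Fin m) (u f : (Fin m → Z) → ℝ) {a c θ : ℝ} (ha : 0 ≤ a)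
    (hθ : 0 ≤ θ)
    (hu : ∀ x b, |u x - u (Function.update x i b)| ≤ a)
    (hf : ∀ x b, |f x - f (Function.update x i b)| ≤ c) :
    ∑ x, p x * (u x - resample p i u x) * Real.exp (θ * f x) ≤
      θ * a * c * ∑ x, p x * Real.exp (θ * f x) := by
  rw [sum_sub_resample_mul hp]
  have hk : ∀ x b, 0 ≤ p x * p (Function.update x i b) /
      (∑ b, p (Function.update x i b)) := fun x b =>
    div_nonneg (mul_nonneg (hp _).le (hp _).le) (sum_update_pos hp i x).le
  have h1 : ∑ x, ∑ b, p x * p (Function.update x i b) / (∑ b, p (Function.update x i b)) *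
        ((u x - u (Function.update x i b)) *
          (Real.exp (θ * f x) - Real.exp (θ * f (Function.update x i b)))) ≤
      ∑ x, ∑ b, p x * p (Function.update x i b) / (∑ b, p (Function.update x i b)) *
        (θ * a * c * (Real.exp (θ * f x) + Real.exp (θ * f (Function.update x i b)))) := by
    refine Finset.sum_le_sum fun x _ => Finset.sum_le_sum fun b _ =>
      mul_le_mul_of_nonneg_left ?_ (hk x b)
    refine (le_abs_self _).trans ?_
    rw [abs_mul]
    have h2 := abs_exp_sub_exp_le (θ * f x) (θ * f (Function.update x i b))
    rw [← mul_sub, abs_mul, abs_of_nonneg hθ] at h2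
    have h3 : |Real.exp (θ * f x) - Real.exp (θ * f (Function.update x i b))| ≤
        θ * c * (Real.exp (θ * f x) + Real.exp (θ * f (Function.update x i b))) :=
      h2.trans (mul_le_mul_of_nonneg_right (mul_le_mul_of_nonneg_left (hf x b) hθ)
        (by positivity))
    calc _ ≤ a * (θ * c * (Real.exp (θ * f x) + Real.exp (θ * f (Function.update x i b)))) :=
          mul_le_mul (hu x b) h3 (abs_nonneg _) ha
      _ = _ := by ring
  have h4 : ∑ x, ∑ b, p x * p (Function.update x i b) / (∑ b, p (Function.update x i b)) *
      Real.exp (θ * f x) = ∑ x, p x * Real.exp (θ * f x) := by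
    refine Finset.sum_congr rfl fun x _ => ?_
    have hs := (sum_update_pos hp i x).ne'
    rw [← Finset.sum_mul, ← Finset.sum_div, ← Finset.mul_sum]
    field_simp
  have h5 : ∑ x, ∑ b, p x * p (Function.update x i b) / (∑ b, p (Function.update x i b)) *
      Real.exp (θ * f (Function.update x i b)) = ∑ x, p x * Real.exp (θ * f x) := by
    rw [← h4]
    refine (sum_update_swap i (fun x y => p x * p y / (∑ b, p (Function.update x i b)) *
      Real.exp (θ * f y))).trans ?_
    refine Finset.sum_congr rfl fun x _ => Finset.sum_congr rfl fun b _ => ?_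
    simp only [Function.update_idem]
    ring
  have h6 : ∑ x, ∑ b, p x * p (Function.update x i b) / (∑ b, p (Function.update x i b)) *
        (θ * a * c * (Real.exp (θ * f x) + Real.exp (θ * f (Function.update x i b)))) =
      θ * a * c * (∑ x, p x * Real.exp (θ * f x) + ∑ x, p x * Real.exp (θ * f x)) := by
    nth_rw 1 [← h4]
    rw [← h5, ← Finset.sum_add_distrib, Finset.mul_sum]
    refine Finset.sum_congr rfl fun x _ => ?_
    rw [← Finset.sum_add_distrib, Finset.mul_sum]
    exact Finset.sum_congr rfl fun b _ => by ring
  linarith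

theorem sub_le_of_odds_le {Q Q' C : ℝ} (hC : 0 ≤ C) (hQ : 0 ≤ Q) (hQ1 : Q ≤ 1)
    (hQ' : 0 ≤ Q') (hQ1' : Q' ≤ 1)
    (h : Q * (1 - Q') ≤ Real.exp (4 * C) * (Q' * (1 - Q))) : Q - Q' ≤ C := by
  by_contra! hlt
  have hQQ : Q' < Q := by linarith
  have h1 : Q < 1 := lt_of_le_of_ne hQ1 fun h1 => by subst h1; nlinarith
  have h0 : 0 < Q' := lt_of_le_of_ne hQ' fun h0 => by subst h0; nlinarith
  have hmono : MonotoneOn (fun x : ℝ => Real.log x - Real.log (1 - x) - 4 * x)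
      (Set.Ioo 0 1) := by
    have hd : ∀ x ∈ Set.Ioo (0 : ℝ) 1,
        HasDerivAt (fun x : ℝ => Real.log x - Real.log (1 - x) - 4 * x)
          (1 / x - (-1) / (1 - x) - 4 * 1) x := fun x hx =>
      (((hasDerivAt_id' x).log hx.1.ne').sub
        (((hasDerivAt_id' x).const_sub 1).log (by linarith [hx.2]))).sub
          ((hasDerivAt_id' x).const_mul 4)
    refine monotoneOn_of_deriv_nonneg (convex_Ioo 0 1)
      (fun x hx => (hd x hx).continuousAt.continuousWithinAt)
      (fun x hx => (hd x (interior_subset hx)).differentiableAt.differentiableWithinAt)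
      fun x hx => ?_
    rw [interior_Ioo] at hx
    rw [(hd x hx).deriv]
    have hx0 := hx.1
    have hx1 : 0 < 1 - x := by linarith [hx.2]
    have : 1 / x - (-1) / (1 - x) - 4 * 1 = (2 * x - 1) ^ 2 / (x * (1 - x)) := by
      field_simp; ring
    rw [this]; positivity
  have h2 := hmono ⟨h0, by linarith⟩ ⟨by linarith, h1⟩ hQQ.le
  have h3 : Real.log (Q * (1 - Q')) ≤ Real.log (Real.exp (4 * C) * (Q' * (1 - Q))) :=
    Real.log_le_log (mul_pos (by linarith) (by linarith)) h
  rw [Real.log_mul (by linarith) (by linarith), Real.log_mul (Real.exp_pos _).ne'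
    (mul_pos h0 (by linarith)).ne', Real.log_exp, Real.log_mul h0.ne' (by linarith)] at h3
  simp only at h2
  linarith

theorem sum_mul_div_sub_le {Z : Type*} [Fintype Z] [Nonempty Z] {r r' f : Z → ℝ} {C c : ℝ}
    (hr : ∀ z, 0 < r z) (hr' : ∀ z, 0 < r' z) (hC : 0 ≤ C)
    (h : ∀ a a', r a * r' a' ≤ Real.exp (4 * C) * (r a' * r' a))
    (hf : ∀ a a', |f a - f a'| ≤ c) :
    (∑ z, r z * f z) / ∑ z, r z - (∑ z, r' z * f z) / ∑ z, r' z ≤ C * c := by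
  have hS : 0 < ∑ z, r z := Finset.sum_pos (fun _ _ => hr _) Finset.univ_nonempty
  have hS' : 0 < ∑ z, r' z := Finset.sum_pos (fun _ _ => hr' _) Finset.univ_nonempty
  set S := ∑ z, r z
  set S' := ∑ z, r' z
  obtain ⟨z0, hz0⟩ := Finite.exists_min f
  set A := Finset.univ.filter fun z => r' z / S' ≤ r z / S with hA
  have hsum : ∑ z, r z / S = 1 := by rw [← Finset.sum_div]; exact div_self hS.ne'
  have hsum' : ∑ z, r' z / S' = 1 := by rw [← Finset.sum_div]; exact div_self hS'.ne'
  set Q := ∑ z ∈ A, r z / S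
  set Q' := ∑ z ∈ A, r' z / S'
  have hQc : 1 - Q = ∑ z ∈ Aᶜ, r z / S := by
    rw [← hsum, ← Finset.sum_add_sum_compl A]; ring
  have hQc' : 1 - Q' = ∑ z ∈ Aᶜ, r' z / S' := by
    rw [← hsum', ← Finset.sum_add_sum_compl A]; ring
  have hpos : ∀ z, 0 ≤ r z / S := fun z => (div_pos (hr z) hS).le
  have hpos' : ∀ z, 0 ≤ r' z / S' := fun z => (div_pos (hr' z) hS').le
  have hTV : Q - Q' ≤ C := by
    refine sub_le_of_odds_le hC (Finset.sum_nonneg fun _ _ => hpos _) ?_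
      (Finset.sum_nonneg fun _ _ => hpos' _) ?_ ?_
    · linarith [Finset.sum_nonneg fun z (_ : z ∈ Aᶜ) => hpos z]
    · linarith [Finset.sum_nonneg fun z (_ : z ∈ Aᶜ) => hpos' z]
    · rw [hQc, hQc', Finset.sum_mul_sum, Finset.sum_mul_sum, Finset.mul_sum]
      refine Finset.sum_le_sum fun a _ => ?_
      rw [Finset.mul_sum]
      refine Finset.sum_le_sum fun a' _ => ?_
      have := h a a'
      rw [div_mul_div_comm, div_mul_div_comm, mul_comm S' S, ← mul_div_assoc]
      refine div_le_div_of_nonneg_right ?_ (by positivity)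
      linarith
  have hc : 0 ≤ c := (abs_nonneg _).trans (hf z0 z0)
  calc (∑ z, r z * f z) / S - (∑ z, r' z * f z) / S'
      = ∑ z, (r z / S - r' z / S') * (f z - f z0) := by
        have : ∀ z, (r z / S - r' z / S') * (f z - f z0) = r z * f z / S - r' z * f z / S' -
            (r z / S * f z0 - r' z / S' * f z0) := fun z => by ring
        rw [Finset.sum_congr rfl fun z _ => this z, Finset.sum_sub_distrib,
          Finset.sum_sub_distrib, Finset.sum_sub_distrib, ← Finset.sum_mul, ← Finset.sum_mul,
          hsum, hsum', Finset.sum_div, Finset.sum_div]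
        ring
    _ ≤ ∑ z ∈ A, (r z / S - r' z / S') * (f z - f z0) := by
        rw [← Finset.sum_add_sum_compl A]
        have : ∑ z ∈ Aᶜ, (r z / S - r' z / S') * (f z - f z0) ≤ 0 := by
          refine Finset.sum_nonpos fun z hz => ?_
          simp only [hA, Finset.mem_compl, Finset.mem_filter, Finset.mem_univ, true_and,
            not_le] at hz
          exact mul_nonpos_of_nonpos_of_nonneg (by linarith) (by linarith [hz0 z])
        linarith
    _ ≤ ∑ z ∈ A, (r z / S - r' z / S') * c := by
        refine Finset.sum_le_sum fun z hz => ?_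
        simp only [hA, Finset.mem_filter, Finset.mem_univ, true_and] at hz
        exact mul_le_mul_of_nonneg_left ((le_abs_self _).trans (hf _ _)) (by linarith)
    _ = (Q - Q') * c := by rw [← Finset.sum_mul, Finset.sum_sub_distrib]
    _ ≤ C * c := mul_le_mul_of_nonneg_right hTV hc

/-- `C i j` bounds the log-influence between the coordinates `i` and `j` of the
(unnormalised) weights `p`. -/
def LogInfluenceLe {Z : Type*} {m : ℕ} (p : (Fin m → Z) → ℝ) (C : Fin m → Fin m → ℝ) : Prop :=
  ∀ i j, i ≠ j → ∀ x a a' b b',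
    p (Function.update (Function.update x j b) i a) *
        p (Function.update (Function.update x j b') i a') ≤
      Real.exp (4 * C i j) * (p (Function.update (Function.update x j b) i a') *
        p (Function.update (Function.update x j b') i a))

/-- Changing any single coordinate changes `f` by at most `c`. -/
def OscLe {Z : Type*} {m : ℕ} (f : (Fin m → Z) → ℝ) (c : ℝ) : Prop :=
  ∀ i x b, |f x - f (Function.update x i b)| ≤ c

theorem LogInfluenceLe.nonneg {Z : Type*} {m : ℕ} {p : (Fin m → Z) → ℝ}
    {C : Fin m → Fin m → ℝ} (hp : ∀ z, 0 < p z) (h : LogInfluenceLe p C) (x : Fin m → Z)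
    {i j : Fin m} (hij : i ≠ j) : 0 ≤ C i j := by
  have h1 := h i j hij x (x i) (x i) (x j) (x j)
  simp only [Function.update_eq_self] at h1
  have h2 : 1 ≤ Real.exp (4 * C i j) :=
    le_of_mul_le_mul_right (by linarith) (mul_pos (hp x) (hp x))
  have := Real.one_le_exp_iff.1 h2
  linarith

theorem abs_resample_sub_le {Z : Type*} [Fintype Z] {m : ℕ} {p : (Fin m → Z) → ℝ}
    {C : Fin m → Fin m → ℝ} (hp : ∀ z, 0 < p z) (h : LogInfluenceLe p C)
    {f : (Fin m → Z) → ℝ} {c : ℝ} (hf : OscLe f c) {i j : Fin m} (hij : i ≠ j)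
    (x : Fin m → Z) (b : Z) :
    |resample p i f x - resample p i f (Function.update x j b)| ≤ c + C i j * c := by
  suffices H : ∀ b b', resample p i f (Function.update x j b) -
      resample p i f (Function.update x j b') ≤ c + C i j * c by
    rw [abs_le]
    have h1 := H (x j) b
    have h2 := H b (x j)
    rw [Function.update_eq_self] at h1 h2
    constructor <;> linarith
  intro b b'
  have : Nonempty Z := ⟨b⟩
  have h1 := sum_mul_div_sub_le (C := C i j) (c := c)
    (r := fun a => p (Function.update (Function.update x j b) i a))
    (r' := fun a => p (Function.update (Function.update x j b') i a))
    (f := fun a => f (Function.update (Function.update x j b) i a))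
    (fun _ => hp _) (fun _ => hp _) (h.nonneg hp x hij)
    (fun a a' => h i j hij x a a' b b')
    (fun a a' => by
      have := hf i (Function.update (Function.update x j b) i a) a'
      simpa only [Function.update_idem] using this)
  have hs := sum_update_pos hp i (Function.update x j b')
  have h2 : (∑ a, p (Function.update (Function.update x j b') i a) *
        f (Function.update (Function.update x j b) i a)) /
        (∑ a, p (Function.update (Function.update x j b') i a)) -
      resample p i f (Function.update x j b') ≤ c := by
    rw [resample, ← sub_div, div_le_iff₀ hs, ← Finset.sum_sub_distrib, Finset.mul_sum]
    refine Finset.sum_le_sum fun a _ => ?_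
    rw [← mul_sub, mul_comm c]
    refine mul_le_mul_of_nonneg_left ((le_abs_self _).trans ?_) (hp _).le
    have := hf j (Function.update (Function.update x j b) i a) b'
    rwa [Function.update_comm hij, Function.update_idem] at this
  unfold resample at h2 ⊢
  linarith

theorem OscLe.glauber {Z : Type*} [Fintype Z] {m : ℕ} {p : (Fin m → Z) → ℝ}
    {C : Fin m → Fin m → ℝ} (hp : ∀ z, 0 < p z) (h : LogInfluenceLe p C) {α : ℝ}
    (hα : ∀ j, ∑ i ∈ Finset.univ.erase j, C i j ≤ α)
    {f : (Fin m → Z) → ℝ} {c : ℝ} (hf : OscLe f c) (hc : 0 ≤ c) :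
    OscLe (glauber p f) (c * (1 - (1 - α) / m)) := by
  intro j x b
  have hm : 0 < m := j.pos
  have hm' : (0 : ℝ) < m := by exact_mod_cast hm
  have h0 : ∀ i, |resample p i f x - resample p i f (Function.update x j b)| ≤
      if i = j then 0 else c + C i j * c := by
    intro i
    split_ifs with hij
    · subst hij
      simp [resample]
    · exact abs_resample_sub_le hp h hf hij x b
  rw [_root_.glauber, _root_.glauber, ← mul_sub, ← Finset.sum_sub_distrib, abs_mul,
    abs_of_pos (inv_pos.2 hm')]
  have h1 : ∑ i, (if i = j then 0 else c + C i j * c) ≤ c * (m - 1 + α) := by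
    rw [← Finset.add_sum_erase _ _ (Finset.mem_univ j)]
    simp only [if_true, zero_add]
    rw [Finset.sum_congr rfl (g := fun i => c + C i j * c) fun i hi => by
      rw [if_neg (Finset.ne_of_mem_erase hi)], Finset.sum_add_distrib, ← Finset.sum_mul,
      Finset.sum_const, Finset.card_erase_of_mem (Finset.mem_univ _), Finset.card_univ,
      Fintype.card_fin, nsmul_eq_mul, Nat.cast_sub hm, Nat.cast_one]
    have := mul_le_mul_of_nonneg_right (hα j) hc
    linarith
  calc (m : ℝ)⁻¹ * |∑ i, (resample p i f x - resample p i f (Function.update x j b))|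
      ≤ (m : ℝ)⁻¹ * (c * (m - 1 + α)) := by
        refine mul_le_mul_of_nonneg_left ?_ (inv_pos.2 hm').le
        exact (Finset.abs_sum_le_sum_abs _ _).trans
          ((Finset.sum_le_sum fun i _ => h0 i).trans h1)
    _ = _ := by field_simp; ring

theorem OscLe.iterate_glauber {Z : Type*} [Fintype Z] {m : ℕ} {p : (Fin m → Z) → ℝ}
    {C : Fin m → Fin m → ℝ} (hp : ∀ z, 0 < p z) (h : LogInfluenceLe p C) {α : ℝ}
    (hα : ∀ j, ∑ i ∈ Finset.univ.erase j, C i j ≤ α) (hρ : 0 ≤ 1 - (1 - α) / m)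
    {f : (Fin m → Z) → ℝ} {c : ℝ} (hf : OscLe f c) (hc : 0 ≤ c) (N : ℕ) :
    OscLe ((_root_.glauber p)^[N] f) (c * (1 - (1 - α) / m) ^ N) := by
  induction N with
  | zero => simpa using hf
  | succ N ih =>
    rw [Function.iterate_succ_apply', pow_succ, ← mul_assoc]
    exact ih.glauber hp h hα (by positivity)

theorem OscLe.abs_sub_le {Z : Type*} {m : ℕ} {f : (Fin m → Z) → ℝ} {c : ℝ} (hf : OscLe f c)
    (x y : Fin m → Z) : |f x - f y| ≤ m * c := by
  have H : ∀ s : Finset (Fin m), |f x - f (s.piecewise y x)| ≤ s.card * c := by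
    intro s
    induction s using Finset.induction_on with
    | empty => simp
    | insert i s hi ih =>
      rw [Finset.piecewise_insert, Finset.card_insert_of_notMem hi]
      have := hf i (s.piecewise y x) (y i)
      have := _root_.abs_sub_le (f x) (f (s.piecewise y x))
        (f (Function.update (s.piecewise y x) i (y i)))
      push_cast
      linarith
  have := H Finset.univ
  simpa using this

theorem OscLe.abs_le_of_sum_eq_zero {Z : Type*} [Fintype Z] {m : ℕ} {p : (Fin m → Z) → ℝ}
    (hp : ∀ z, 0 < p z) {f : (Fin m → Z) → ℝ} {c : ℝ} (hf : OscLe f c)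
    (h0 : ∑ x, p x * f x = 0) (x : Fin m → Z) : |f x| ≤ m * c := by
  have hS : 0 < ∑ y, p y := Finset.sum_pos (fun _ _ => hp _) ⟨x, Finset.mem_univ _⟩
  have h1 : (∑ y, p y) * f x = ∑ y, p y * (f x - f y) := by
    simp only [mul_sub, Finset.sum_sub_distrib, h0, sub_zero, Finset.sum_mul]
  have h2 : (∑ y, p y) * |f x| ≤ (∑ y, p y) * (m * c) := by
    rw [← abs_of_pos hS, ← abs_mul, h1, abs_of_pos hS, Finset.sum_mul]
    refine (Finset.abs_sum_le_sum_abs _ _).trans (Finset.sum_le_sum fun y _ => ?_)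
    rw [abs_mul, abs_of_pos (hp y)]
    exact mul_le_mul_of_nonneg_left (hf.abs_sub_le x y) (hp y).le
  exact le_of_mul_le_mul_left h2 hS

theorem OscLe.sum {Z : Type*} {m : ℕ} {f : ℕ → (Fin m → Z) → ℝ} {c : ℕ → ℝ}
    (hf : ∀ k, OscLe (f k) (c k)) (N : ℕ) :
    OscLe (fun x => ∑ k ∈ Finset.range N, f k x) (∑ k ∈ Finset.range N, c k) := by
  intro i x b
  rw [← Finset.sum_sub_distrib]
  exact (Finset.abs_sum_le_sum_abs _ _).trans (Finset.sum_le_sum fun k _ => hf k i x b)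

/-- The key differential inequality of the exchangeable-pairs method. -/
theorem sum_mul_exp_le {Z : Type*} [Fintype Z] {m : ℕ} {p : (Fin m → Z) → ℝ}
    {C : Fin m → Fin m → ℝ} (hp : ∀ z, 0 < p z) (h : LogInfluenceLe p C) {α : ℝ}
    (hα : ∀ j, ∑ i ∈ Finset.univ.erase j, C i j ≤ α) (hα0 : 0 ≤ α) (hα1 : α < 1)
    {f : (Fin m → Z) → ℝ} {c : ℝ} (hc : 0 ≤ c) (T : Finset (Fin m))
    (hf : ∀ i x b, |f x - f (Function.update x i b)| ≤ if i ∈ T then c else 0)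
    (h0 : ∑ x, p x * f x = 0) {θ : ℝ} (hθ : 0 ≤ θ) :
    ∑ x, p x * f x * Real.exp (θ * f x) ≤
      θ * (c ^ 2 * T.card / (1 - α)) * ∑ x, p x * Real.exp (θ * f x) := by
  have hosc : OscLe f c := fun i x b => (hf i x b).trans (by split_ifs <;> simp [hc])
  rcases Nat.eq_zero_or_pos m with rfl | hm
  · have hz : ∀ x, f x = 0 := fun x => by
      have := hosc.abs_le_of_sum_eq_zero hp h0 x
      simpa using this
    have hT : T = ∅ := Finset.eq_empty_of_isEmpty T
    simp [hz, hT]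
  have hm' : (0 : ℝ) < m := by exact_mod_cast hm
  have hm1 : (1 : ℝ) ≤ m := by exact_mod_cast hm
  set ρ : ℝ := 1 - (1 - α) / m with hρ
  have hρ0 : 0 ≤ ρ := by
    have : (1 - α) / m ≤ 1 := by rw [div_le_one hm']; linarith
    linarith
  have hρ1 : ρ < 1 := by
    have : 0 < (1 - α) / m := div_pos (by linarith) hm'
    linarith
  have hit : ∀ N, OscLe ((glauber p)^[N] f) (c * ρ ^ N) := fun N =>
    hosc.iterate_glauber hp h hα hρ0 hc N
  have hit0 : ∀ N, ∑ x, p x * (glauber p)^[N] f x = 0 := by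
    intro N
    induction N with
    | zero => simpa using h0
    | succ N ih => rw [Function.iterate_succ_apply', sum_glauber hm hp, ih]
  set φ := ∑ x, p x * Real.exp (θ * f x) with hφ
  have hφ0 : 0 ≤ φ := Finset.sum_nonneg fun x _ => mul_nonneg (hp x).le (Real.exp_pos _).le
  have main : ∀ N, ∑ x, p x * f x * Real.exp (θ * f x) ≤
      θ * (c ^ 2 * T.card / (1 - α)) * φ + m * (c * ρ ^ N) * φ := by
    intro N
    set g : (Fin m → Z) → ℝ := fun x => ∑ k ∈ Finset.range N, (glauber p)^[k] f x with hg
    have hgosc : OscLe g (c * m / (1 - α)) := fun i x b => by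
      refine (OscLe.sum hit N i x b).trans ?_
      rw [← Finset.mul_sum, mul_div_assoc]
      refine mul_le_mul_of_nonneg_left ?_ hc
      have hgeom : (∑ k ∈ Finset.range N, ρ ^ k) * (1 - ρ) = 1 - ρ ^ N := geom_sum_mul_neg ρ N
      have : 1 - ρ = (1 - α) / m := by rw [hρ]; ring
      rw [this] at hgeom
      rw [le_div_iff₀ (by linarith)]
      have h3 : (∑ k ∈ Finset.range N, ρ ^ k) * (1 - α) = m * (1 - ρ ^ N) := by
        rw [← hgeom]; field_simp
      rw [h3]
      have : 0 ≤ ρ ^ N := pow_nonneg hρ0 N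
      nlinarith
    have hres : ∀ i x, resample p i g x =
        ∑ k ∈ Finset.range N, resample p i ((glauber p)^[k] f) x := by
      intro i x
      simp only [resample, hg, Finset.mul_sum]
      rw [Finset.sum_comm, Finset.sum_div]
    have htel : ∀ x, f x - (glauber p)^[N] f x =
        (m : ℝ)⁻¹ * ∑ i, (g x - resample p i g x) := by
      intro x
      have h1 : ∑ k ∈ Finset.range N,
          ((glauber p)^[k + 1] f x - (glauber p)^[k] f x) =
          (glauber p)^[N] f x - f x :=
        Finset.sum_range_sub (fun k => (glauber p)^[k] f x) N
      have h2 : ∑ i, resample p i g x =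
          m * ∑ k ∈ Finset.range N, (glauber p)^[k + 1] f x := by
        simp only [hres]
        rw [Finset.sum_comm, Finset.mul_sum]
        refine Finset.sum_congr rfl fun k _ => ?_
        rw [Function.iterate_succ_apply', glauber]
        field_simp
      rw [Finset.sum_sub_distrib, h2]
      rw [Finset.sum_sub_distrib] at h1
      simp only [Finset.sum_const, Finset.card_univ, Fintype.card_fin, nsmul_eq_mul]
      rw [← mul_sub, inv_mul_cancel_left₀ hm'.ne']
      linarith
    have hA : ∑ x, p x * (f x - (glauber p)^[N] f x) * Real.exp (θ * f x) ≤
        θ * (c ^ 2 * T.card / (1 - α)) * φ := by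
      have h1 : ∑ x, p x * (f x - (glauber p)^[N] f x) * Real.exp (θ * f x) =
          (m : ℝ)⁻¹ * ∑ i, ∑ x, p x * (g x - resample p i g x) * Real.exp (θ * f x) := by
        rw [Finset.sum_comm, Finset.mul_sum]
        refine Finset.sum_congr rfl fun x _ => ?_
        rw [htel, ← Finset.sum_mul, ← Finset.mul_sum]
        ring
      have h2 : ∑ i, ∑ x, p x * (g x - resample p i g x) * Real.exp (θ * f x) ≤
          ∑ i, θ * (c * m / (1 - α)) * (if i ∈ T then c else 0) * φ :=
        Finset.sum_le_sum fun i _ =>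
          sum_sub_resample_mul_exp_le hp i g f
            (div_nonneg (by positivity) (by linarith)) hθ (hgosc i) (hf i)
      rw [h1]
      refine (mul_le_mul_of_nonneg_left h2 (inv_pos.2 hm').le).trans (le_of_eq ?_)
      rw [← Finset.sum_mul, ← Finset.mul_sum, Finset.sum_ite_mem, Finset.univ_inter,
        Finset.sum_const, nsmul_eq_mul]
      have : 1 - α ≠ 0 := by linarith
      field_simp
    have hB : ∑ x, p x * (glauber p)^[N] f x * Real.exp (θ * f x) ≤
        m * (c * ρ ^ N) * φ := by
      rw [hφ, Finset.mul_sum]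
      refine Finset.sum_le_sum fun x _ => ?_
      have h1 := (le_abs_self _).trans ((hit N).abs_le_of_sum_eq_zero hp (hit0 N) x)
      have h2 : 0 ≤ p x * Real.exp (θ * f x) := mul_nonneg (hp x).le (Real.exp_pos _).le
      nlinarith
    have hAB : ∑ x, p x * f x * Real.exp (θ * f x) =
        ∑ x, p x * (f x - (glauber p)^[N] f x) * Real.exp (θ * f x) +
        ∑ x, p x * (glauber p)^[N] f x * Real.exp (θ * f x) := by
      rw [← Finset.sum_add_distrib]
      exact Finset.sum_congr rfl fun x _ => by ring
    linarith
  have hlim : Filter.Tendsto (fun N : ℕ => θ * (c ^ 2 * T.card / (1 - α)) * φ +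
      m * (c * ρ ^ N) * φ) Filter.atTop
      (nhds (θ * (c ^ 2 * T.card / (1 - α)) * φ + m * (c * 0) * φ)) :=
    ((((tendsto_pow_atTop_nhds_zero_of_lt_one hρ0 hρ1).const_mul c).const_mul
      (m : ℝ)).mul_const φ).const_add _
  have := ge_of_tendsto' hlim main
  simpa using this

/-- Sub-Gaussian moment generating function under Dobrushin's condition. -/
theorem sum_exp_le {Z : Type*} [Fintype Z] {m : ℕ} {p : (Fin m → Z) → ℝ}
    {C : Fin m → Fin m → ℝ} (hp : ∀ z, 0 < p z) (h : LogInfluenceLe p C) {α : ℝ}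
    (hα : ∀ j, ∑ i ∈ Finset.univ.erase j, C i j ≤ α) (hα0 : 0 ≤ α) (hα1 : α < 1)
    {f : (Fin m → Z) → ℝ} {c : ℝ} (hc : 0 ≤ c) (T : Finset (Fin m))
    (hf : ∀ i x b, |f x - f (Function.update x i b)| ≤ if i ∈ T then c else 0)
    (h0 : ∑ x, p x * f x = 0) {θ : ℝ} (hθ : 0 ≤ θ) :
    ∑ x, p x * Real.exp (θ * f x) ≤
      (∑ x, p x) * Real.exp (θ ^ 2 * (c ^ 2 * T.card / (1 - α)) / 2) := by
  set K := c ^ 2 * T.card / (1 - α)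
  have hφ : ∀ t : ℝ, HasDerivAt (fun t => ∑ x, p x * Real.exp (t * f x))
      (∑ x, p x * f x * Real.exp (t * f x)) t := by
    intro t
    refine HasDerivAt.fun_sum fun x _ => ?_
    exact (((hasDerivAt_id' t).mul_const (f x)).exp.const_mul (p x)).congr_deriv (by ring)
  have hE : ∀ t : ℝ, HasDerivAt (fun t : ℝ => Real.exp (-(t ^ 2 * K / 2)))
      (Real.exp (-(t ^ 2 * K / 2)) * (-(t * K))) t := by
    intro t
    have := ((((hasDerivAt_pow 2 t).mul_const K).div_const 2).fun_neg).exp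
    convert this using 2
    push_cast
    ring
  have hd := fun t => (hφ t).fun_mul (hE t)
  have hanti : AntitoneOn (fun t => (∑ x, p x * Real.exp (t * f x)) *
      Real.exp (-(t ^ 2 * K / 2))) (Set.Ici 0) := by
    refine antitoneOn_of_deriv_nonpos (convex_Ici 0)
      (fun t _ => (hd t).continuousAt.continuousWithinAt)
      (fun t _ => (hd t).differentiableAt.differentiableWithinAt) fun t ht => ?_
    rw [interior_Ici] at ht
    rw [(hd t).deriv]
    have h1 := sum_mul_exp_le hp h hα hα0 hα1 hc T hf h0 (le_of_lt ht)
    have h2 := Real.exp_pos (-(t ^ 2 * K / 2))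
    have h3 := mul_le_mul_of_nonneg_right h1 h2.le
    linarith
  have h1 := hanti (Set.self_mem_Ici) hθ hθ
  simp only [zero_mul, Real.exp_zero, mul_one, ne_eq, OfNat.ofNat_ne_zero, not_false_eq_true,
    zero_pow, zero_div, neg_zero] at h1
  rw [Real.exp_neg, ← div_eq_mul_inv, div_le_iff₀ (Real.exp_pos _)] at h1
  exact h1

theorem vcDim_image_preimage_le {α β : Type*} [Fintype α] [DecidableEq α] [DecidableEq β]
    (𝒜 : Finset (Finset β)) (φ : α → β) :
    (𝒜.image fun A => Finset.univ.filter fun a => φ a ∈ A).vcDim ≤ 𝒜.vcDim := by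
  refine Finset.sup_le fun s hs => ?_
  rw [Finset.mem_shatterer] at hs
  have hinj : Set.InjOn φ s := by
    intro a ha a' ha' haa
    by_contra hne
    obtain ⟨u, hu, hsu⟩ := hs.exists_inter_eq_singleton ha
    obtain ⟨A, -, rfl⟩ := Finset.mem_image.1 hu
    have h1 : a ∈ s ∩ Finset.univ.filter fun a => φ a ∈ A := by rw [hsu]; simp
    have h2 : a' ∈ s ∩ Finset.univ.filter fun a => φ a ∈ A := by
      simp only [Finset.mem_inter, Finset.mem_filter, Finset.mem_univ, true_and] at h1 ⊢
      exact ⟨ha', haa ▸ h1.2⟩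
    rw [hsu, Finset.mem_singleton] at h2
    exact hne h2.symm
  rw [← Finset.card_image_of_injOn hinj]
  refine Finset.Shatters.card_le_vcDim fun t ht => ?_
  obtain ⟨u, hu, hsu⟩ := hs (Finset.filter_subset (fun a => φ a ∈ t) s)
  obtain ⟨A, hA, rfl⟩ := Finset.mem_image.1 hu
  refine ⟨A, hA, ?_⟩
  ext b
  simp only [Finset.mem_inter, Finset.mem_image]
  have key : ∀ a ∈ s, (φ a ∈ A ↔ φ a ∈ t) := by
    intro a ha
    have := congrArg (a ∈ ·) hsu
    simpa [ha] using this
  constructor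
  · rintro ⟨⟨a, ha, rfl⟩, hb⟩
    exact (key a ha).1 hb
  · intro hb
    obtain ⟨a, ha, rfl⟩ := Finset.mem_image.1 (ht hb)
    exact ⟨⟨a, ha, rfl⟩, (key a ha).2 hb⟩

theorem pow_mul_card_le_exp {α : Type*} [Fintype α] [DecidableEq α] (𝒜 : Finset (Finset α))
    {d : ℕ} (hd : 𝒜.vcDim ≤ d) {l : ℝ} (hl : 0 < l) (hl1 : l ≤ 1) :
    l ^ d * (𝒜.card : ℝ) ≤ Real.exp (l * Fintype.card α) := by
  set n := Fintype.card α with hn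
  have h1 : (𝒜.card : ℝ) ≤ ∑ k ∈ Finset.Iic d, (n.choose k : ℝ) := by
    have h2 := 𝒜.card_le_card_shatterer.trans Finset.card_shatterer_le_sum_vcDim
    have h3 : ∑ k ∈ Finset.Iic 𝒜.vcDim, n.choose k ≤ ∑ k ∈ Finset.Iic d, n.choose k :=
      Finset.sum_le_sum_of_subset (Finset.Iic_subset_Iic.2 hd)
    exact_mod_cast h2.trans h3
  have h4 : l ^ d * ∑ k ∈ Finset.Iic d, (n.choose k : ℝ) ≤
      ∑ k ∈ Finset.Iic d, l ^ k * (n.choose k : ℝ) := by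
    rw [Finset.mul_sum]
    exact Finset.sum_le_sum fun k hk => mul_le_mul_of_nonneg_right
      (pow_le_pow_of_le_one hl.le hl1 (Finset.mem_Iic.1 hk)) (Nat.cast_nonneg _)
  have h5 : ∑ k ∈ Finset.Iic d, l ^ k * (n.choose k : ℝ) ≤
      ∑ k ∈ Finset.range (n + 1), l ^ k * (n.choose k : ℝ) := by
    rw [Finset.sum_subset (s₁ := Finset.range (n + 1))
      (Finset.subset_union_right (s₁ := Finset.Iic d)) fun k _ hk => by
      rw [Nat.choose_eq_zero_of_lt (by simpa using hk)]; simp]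
    exact Finset.sum_le_sum_of_subset_of_nonneg Finset.subset_union_left
      fun _ _ _ => by positivity
  have h6 : ∑ k ∈ Finset.range (n + 1), l ^ k * (n.choose k : ℝ) = (l + 1) ^ n := by
    rw [add_pow]
    simp
  calc l ^ d * (𝒜.card : ℝ) ≤ (l + 1) ^ n := by
        rw [← h6]
        exact (mul_le_mul_of_nonneg_left h1 (by positivity)).trans (h4.trans h5)
    _ ≤ Real.exp l ^ n := pow_le_pow_left₀ (by positivity) (Real.add_one_le_exp l) n
    _ = _ := by rw [← Real.exp_nat_mul, mul_comm]

/-- If the members of a finite family of subsets differ pairwise on a proportion at least `η`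
of the ground set, some `s` points separate all of them once `s ≥ (2 / η) log |N|`. -/
theorem exists_separating {ι : Type*} [Fintype ι] [DecidableEq ι] (N : Finset (Finset ι))
    {η : ℝ}
    (hsep : ∀ A ∈ N, ∀ B ∈ N, A ≠ B → η * Fintype.card ι ≤ (symmDiff A B).card)
    (hN : 1 < N.card) {s : ℕ} (hs : 2 * Real.log N.card ≤ η * s) :
    ∃ φ : Fin s → ι, Set.InjOn (fun A : Finset ι => Finset.univ.filter fun i => φ i ∈ A) N := by
  by_contra! hcon
  have hι : 0 < Fintype.card ι := by
    rw [Fintype.card_pos_iff]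
    by_contra h
    rw [not_nonempty_iff] at h
    have := Finset.card_le_one.2 fun A _ B (_ : B ∈ N) => Subsingleton.elim A B
    omega
  have hcov : (Finset.univ : Finset (Fin s → ι)) ⊆
      N.offDiag.biUnion fun q => Fintype.piFinset fun _ => (symmDiff q.1 q.2)ᶜ := by
    intro φ _
    have := hcon φ
    simp only [Set.InjOn] at this
    push Not at this
    obtain ⟨A, hA, B, hB, hAB, hne⟩ := this
    simp only [Finset.mem_biUnion, Finset.mem_offDiag, Fintype.mem_piFinset,
      Finset.mem_compl, Finset.mem_symmDiff]
    refine ⟨(A, B), ⟨hA, hB, hne⟩, fun i => ?_⟩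
    have := congrArg (i ∈ ·) hAB
    simp only [Finset.mem_filter, Finset.mem_univ, true_and, eq_iff_iff] at this
    tauto
  have h1 := (Finset.card_le_card hcov).trans Finset.card_biUnion_le
  simp only [Fintype.card_piFinset_const, Finset.card_univ, Fintype.card_fun,
    Fintype.card_fin] at h1
  set n := Fintype.card ι
  have hn : (0 : ℝ) < n := by exact_mod_cast hι
  have h2 : ∀ q ∈ N.offDiag, (((symmDiff q.1 q.2)ᶜ.card ^ s : ℕ) : ℝ) ≤
      n ^ s * Real.exp (-(η * s)) := by
    intro q hq
    rw [Finset.mem_offDiag] at hq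
    have h3 := hsep _ hq.1 _ hq.2.1 hq.2.2
    have h4 : ((symmDiff q.1 q.2)ᶜ.card : ℝ) ≤ n * Real.exp (-η) := by
      rw [Finset.card_compl, Nat.cast_sub (Finset.card_le_univ _)]
      have := Real.add_one_le_exp (-η)
      nlinarith
    push_cast
    refine (pow_le_pow_left₀ (Nat.cast_nonneg _) h4 s).trans (le_of_eq ?_)
    rw [mul_pow, ← Real.exp_nat_mul]
    ring_nf
  have h5 : ((n ^ s : ℕ) : ℝ) ≤
      ((N.card * N.card - N.card : ℕ) : ℝ) * (n ^ s * Real.exp (-(η * s))) := by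
    refine (Nat.cast_le.2 h1).trans ?_
    rw [Nat.cast_sum, ← Finset.offDiag_card, ← nsmul_eq_mul]
    exact Finset.sum_le_card_nsmul _ _ _ h2
  have hM : (1 : ℝ) < N.card := by exact_mod_cast hN
  have h6 : Real.exp (-(η * s)) ≤ ((N.card : ℝ) ^ 2)⁻¹ := by
    rw [Real.exp_neg]
    refine inv_anti₀ (by positivity) ?_
    rw [← Real.exp_log (show (0 : ℝ) < (N.card : ℝ) ^ 2 by positivity), Real.log_pow]
    exact Real.exp_le_exp.2 (by exact_mod_cast hs)
  rw [Nat.cast_sub (Nat.le_mul_self _)] at h5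
  push_cast at h5
  have h7 : (0 : ℝ) < (n : ℝ) ^ s := by positivity
  have h8 : ((N.card : ℝ) * N.card - N.card) * ((n : ℝ) ^ s * Real.exp (-(η * s))) ≤
      ((N.card : ℝ) * N.card - N.card) * ((n : ℝ) ^ s * ((N.card : ℝ) ^ 2)⁻¹) :=
    mul_le_mul_of_nonneg_left (mul_le_mul_of_nonneg_left h6 h7.le) (by nlinarith)
  have h9 : ((N.card : ℝ) * N.card - N.card) * ((n : ℝ) ^ s * ((N.card : ℝ) ^ 2)⁻¹) =
      (n : ℝ) ^ s - (n : ℝ) ^ s / N.card := by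
    field_simp
  have : 0 < (n : ℝ) ^ s / N.card := by positivity
  linarith

/-- A bound on the packing numbers of a family of bounded VC dimension. -/
theorem log_card_le_of_separated {ι : Type*} [Fintype ι] [DecidableEq ι]
    (N : Finset (Finset ι)) {d : ℕ} (hd1 : 1 ≤ d) (hd : N.vcDim ≤ d) {η : ℝ} (hη : 0 < η)
    (hη1 : η ≤ 1)
    (hsep : ∀ A ∈ N, ∀ B ∈ N, A ≠ B → η * Fintype.card ι ≤ (symmDiff A B).card) :
    Real.log N.card ≤ 2 * d * (Real.log (4 / η) + 1) := by
  have hd1' : (1 : ℝ) ≤ d := by exact_mod_cast hd1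
  have hlog : 0 ≤ Real.log (4 / η) :=
    Real.log_nonneg (by rw [le_div_iff₀ hη]; linarith)
  rcases Nat.lt_or_ge 1 N.card with hN | hN
  · obtain ⟨s, hs, hceil⟩ : ∃ s : ℕ, 2 * Real.log N.card ≤ η * s ∧
        (s : ℝ) ≤ 2 * Real.log N.card / η + 1 := by
      refine ⟨⌈2 * Real.log N.card / η⌉₊, ?_, (Nat.ceil_lt_add_one
        (div_nonneg (mul_nonneg zero_le_two (Real.log_natCast_nonneg _)) hη.le)).le⟩
      have := Nat.le_ceil (2 * Real.log N.card / η)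
      rw [div_le_iff₀ hη] at this
      linarith
    obtain ⟨φ, hφ⟩ := exists_separating N hsep hN hs
    have h1 := pow_mul_card_le_exp _ ((vcDim_image_preimage_le N φ).trans hd)
      (l := η / 4) (by positivity) (by linarith)
    rw [Finset.card_image_of_injOn hφ, Fintype.card_fin] at h1
    have hM : (0 : ℝ) < N.card := by exact_mod_cast (by omega : 0 < N.card)
    have h2 := Real.log_le_log (by positivity) h1
    rw [Real.log_exp, Real.log_mul (by positivity) hM.ne', Real.log_pow] at h2
    have h3 : Real.log (η / 4) = -Real.log (4 / η) := by rw [← Real.log_inv, inv_div]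
    rw [h3] at h2
    have h4 : η / 4 * s ≤ Real.log N.card / 2 + η / 4 := by
      calc η / 4 * s ≤ η / 4 * (2 * Real.log N.card / η + 1) :=
            mul_le_mul_of_nonneg_left hceil (by positivity)
        _ = _ := by field_simp; ring
    nlinarith
  · have : Real.log N.card ≤ 0 := Real.log_nonpos (by positivity) (by exact_mod_cast hN)
    have : 0 ≤ 2 * d * (Real.log (4 / η) + 1) := by positivity
    linarith

theorem exists_net {ι : Type*} [DecidableEq ι] (F : Finset (Finset ι)) {r : ℝ} (hr : 0 ≤ r) :
    ∃ N ⊆ F, (∀ A ∈ N, ∀ B ∈ N, A ≠ B → r < (symmDiff A B).card) ∧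
      ∀ A ∈ F, ∃ B ∈ N, ((symmDiff A B).card : ℝ) ≤ r := by
  obtain ⟨N, hN, hmax⟩ := Finset.exists_max_image
    (F.powerset.filter fun N => ∀ A ∈ N, ∀ B ∈ N, A ≠ B → r < (symmDiff A B).card)
    Finset.card ⟨∅, by simp⟩
  simp only [Finset.mem_filter, Finset.mem_powerset] at hN hmax
  refine ⟨N, hN.1, hN.2, fun A hA => ?_⟩
  by_contra! hcon
  have hAN : A ∉ N := fun h => by
    have := hcon A h
    simp at this
    linarith
  have := hmax (insert A N) ⟨Finset.insert_subset hA hN.1, fun B hB B' hB' hne => by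
    rw [Finset.mem_insert] at hB hB'
    rcases hB with rfl | hB <;> rcases hB' with rfl | hB'
    · exact absurd rfl hne
    · exact hcon _ hB'
    · rw [symmDiff_comm]
      exact hcon _ hB
    · exact hN.2 _ hB _ hB' hne⟩
  rw [Finset.card_insert_of_notMem hAN] at this
  omega

/-- The maximal inequality for finitely many sub-Gaussian variables. -/
theorem sum_mul_sup_le {I Ω : Type*} [Fintype Ω] (N : Finset I) (hN : N.Nonempty)
    {w : Ω → ℝ} (hw : ∀ ω, 0 ≤ w ω) (Y : I → Ω → ℝ) {θ V : ℝ} (hθ : 0 < θ)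
    (hY : ∀ i ∈ N, ∑ ω, w ω * Real.exp (θ * Y i ω) ≤ (∑ ω, w ω) * Real.exp (θ ^ 2 * V / 2)) :
    ∑ ω, w ω * N.sup' hN (fun i => Y i ω) ≤
      (∑ ω, w ω) * (Real.log N.card / θ + θ * V / 2) := by
  have hc : (0 : ℝ) < N.card := by exact_mod_cast hN.card_pos
  set L := Real.log N.card + θ ^ 2 * V / 2 with hL
  have h1 : ∀ ω, θ * N.sup' hN (fun i => Y i ω) ≤
      L - 1 + Real.exp (-L) * ∑ i ∈ N, Real.exp (θ * Y i ω) := by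
    intro ω
    obtain ⟨i, hi, hsup⟩ := N.exists_mem_eq_sup' hN (fun i => Y i ω)
    rw [hsup]
    have h2 := Real.add_one_le_exp (-L + θ * Y i ω)
    rw [Real.exp_add] at h2
    have h3 : Real.exp (θ * Y i ω) ≤ ∑ i ∈ N, Real.exp (θ * Y i ω) :=
      Finset.single_le_sum (f := fun i => Real.exp (θ * Y i ω))
        (fun _ _ => (Real.exp_pos _).le) hi
    have := mul_le_mul_of_nonneg_left h3 (Real.exp_pos (-L)).le
    linarith
  have h2 : θ * ∑ ω, w ω * N.sup' hN (fun i => Y i ω) ≤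
      (∑ ω, w ω) * (L - 1) + Real.exp (-L) * ∑ i ∈ N, ∑ ω, w ω * Real.exp (θ * Y i ω) := by
    rw [Finset.sum_comm, Finset.mul_sum, Finset.sum_mul, Finset.mul_sum,
      ← Finset.sum_add_distrib]
    refine Finset.sum_le_sum fun ω _ => ?_
    have := mul_le_mul_of_nonneg_left (h1 ω) (hw ω)
    rw [← Finset.mul_sum]
    linarith
  have h3 : Real.exp (-L) * ∑ i ∈ N, ∑ ω, w ω * Real.exp (θ * Y i ω) ≤ ∑ ω, w ω := by
    have h4 : ∑ i ∈ N, ∑ ω, w ω * Real.exp (θ * Y i ω) ≤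
        N.card * ((∑ ω, w ω) * Real.exp (θ ^ 2 * V / 2)) := by
      rw [← nsmul_eq_mul]
      exact Finset.sum_le_card_nsmul _ _ _ hY
    have h5 : Real.exp (-L) * (N.card * Real.exp (θ ^ 2 * V / 2)) = 1 := by
      rw [← Real.exp_log hc, ← Real.exp_add, ← Real.exp_add, Real.exp_eq_one_iff, hL]
      simp
    calc _ ≤ Real.exp (-L) * (N.card * ((∑ ω, w ω) * Real.exp (θ ^ 2 * V / 2))) :=
          mul_le_mul_of_nonneg_left h4 (Real.exp_pos _).le
      _ = (∑ ω, w ω) * (Real.exp (-L) * (N.card * Real.exp (θ ^ 2 * V / 2))) := by ring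
      _ = _ := by rw [h5, mul_one]
  have h6 : θ * ∑ ω, w ω * N.sup' hN (fun i => Y i ω) ≤
      θ * ((∑ ω, w ω) * (Real.log N.card / θ + θ * V / 2)) := by
    have : θ * ((∑ ω, w ω) * (Real.log N.card / θ + θ * V / 2)) = (∑ ω, w ω) * L := by
      rw [hL]; field_simp
    rw [this]
    linarith
  exact le_of_mul_le_mul_left h6 hθ

theorem card_le_one_of_vcDim_eq_zero {ι : Type*} [Fintype ι] [DecidableEq ι]
    (F : Finset (Finset ι)) (h : F.vcDim = 0) : F.card ≤ 1 := by
  have := F.card_le_card_shatterer.trans Finset.card_shatterer_le_sum_vcDim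
  simpa [h, Finset.Iic_eq_Icc] using this

/-- Chaining bound for a centred process indexed by a family of finite VC dimension, with
sub-Gaussian increments. -/
theorem sum_mul_sup_le_of_vcDim_le {ι Ω : Type*} [Fintype ι] [DecidableEq ι] [Fintype Ω]
    (F : Finset (Finset ι)) (hF : F.Nonempty) {d : ℕ} (hd : F.vcDim ≤ d)
    {w : Ω → ℝ} (hw : ∀ ω, 0 ≤ w ω) (Y : Finset ι → Ω → ℝ) {v : ℝ} (hv : 0 < v)
    (hY : ∀ A ∈ F, ∀ B ∈ F, ∀ θ : ℝ, 0 ≤ θ → ∑ ω, w ω * Real.exp (θ * (Y A ω - Y B ω)) ≤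
      (∑ ω, w ω) * Real.exp (θ ^ 2 * (v * (symmDiff A B).card) / 2))
    (h0 : ∀ A ∈ F, ∑ ω, w ω * Y A ω = 0) :
    ∑ ω, w ω * F.sup' hF (fun A => Y A ω) ≤
      (∑ ω, w ω) * (30 * √(v * Fintype.card ι * d)) := by
  have hW : 0 ≤ ∑ ω, w ω := Finset.sum_nonneg fun _ _ => hw _
  have single : ∀ (N : Finset (Finset ι)) (hN : N.Nonempty), N ⊆ F → N.card ≤ 1 →
      ∑ ω, w ω * N.sup' hN (fun A => Y A ω) = 0 := by
    intro N hN hNF hc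
    obtain ⟨A, rfl⟩ := Finset.card_eq_one.1 (le_antisymm hc hN.card_pos)
    simpa using h0 A (hNF (Finset.mem_singleton_self A))
  rcases Nat.lt_or_ge 1 F.card with hF1 | hF1
  swap
  · rw [single F hF subset_rfl hF1]
    positivity
  have hd1 : 1 ≤ d := by
    by_contra h
    have := card_le_one_of_vcDim_eq_zero F (by omega)
    omega
  have hn : 0 < Fintype.card ι := by
    rw [Fintype.card_pos_iff]
    by_contra h
    rw [not_nonempty_iff] at h
    have := Finset.card_le_one.2 fun A _ B (_ : B ∈ F) => Subsingleton.elim A B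
    omega
  set n := Fintype.card ι with hn_def
  have hn' : (0 : ℝ) < n := by exact_mod_cast hn
  have hd' : (0 : ℝ) < d := by exact_mod_cast hd1
  set S := √(v * n * d)
  have hS : 0 < S := Real.sqrt_pos.2 (by positivity)
  have hS2 : S * S = v * n * d := Real.mul_self_sqrt (by positivity)
  choose N hNF hsep hnet using fun k : ℕ => exists_net F (r := (1 / 4) ^ k * n) (by positivity)
  have hNne : ∀ k, (N k).Nonempty := fun k => by
    obtain ⟨A, hA⟩ := hF
    obtain ⟨B, hB, -⟩ := hnet k A hA
    exact ⟨B, hB⟩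
  have hE : ∀ k, ∑ ω, w ω * (N k).sup' (hNne k) (fun A => Y A ω) ≤
      (∑ ω, w ω) * (S * (30 - (1 / 2) ^ k * (8 * k + 30))) := by
    intro k
    induction k with
    | zero =>
      rw [single (N 0) (hNne 0) (hNF 0)]
      · simp
      · refine Finset.card_le_one.2 fun A hA B hB => ?_
        by_contra hne
        have h1 := hsep 0 A hA B hB hne
        have h2 : ((symmDiff A B).card : ℝ) ≤ n := by exact_mod_cast Finset.card_le_univ _
        simp only [pow_zero, one_mul] at h1
        linarith
    | succ k ih =>
      choose! pr hpr hprd using hnet k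
      have hθ : 0 < d / S * 2 ^ k := by positivity
      have hmax := sum_mul_sup_le (N (k + 1)) (hNne (k + 1)) hw
        (fun A ω => Y A ω - Y (pr A) ω) (V := v * ((1 / 4) ^ k * n)) hθ fun A hA => by
          refine (hY A (hNF _ hA) _ (hNF _ (hpr A (hNF _ hA))) _ hθ.le).trans ?_
          have := hprd A (hNF _ hA)
          gcongr
      have hlog : Real.log (N (k + 1)).card ≤ 2 * d * (2 * k + 5) := by
        refine (log_card_le_of_separated (N (k + 1)) hd1
          ((Finset.vcDim_mono (hNF _)).trans hd) (η := (1 / 4) ^ (k + 1)) (by positivity)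
          (pow_le_one₀ (by norm_num) (by norm_num))
          fun A hA B hB hne => (hsep (k + 1) A hA B hB hne).le).trans ?_
        refine mul_le_mul_of_nonneg_left ?_ (by positivity)
        have h4 : (4 : ℝ) / (1 / 4) ^ (k + 1) = 4 ^ (k + 2) := by
          rw [one_div, inv_pow, div_inv_eq_mul]; ring
        have h5 : Real.log 4 ≤ 2 := by
          have h6 : (4 : ℝ) = 2 ^ 2 := by norm_num
          rw [h6, Real.log_pow]
          have := Real.log_two_lt_d9
          push_cast
          linarith
        rw [h4, Real.log_pow]
        push_cast
        have : ((k : ℝ) + 2) * Real.log 4 ≤ (k + 2) * 2 :=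
          mul_le_mul_of_nonneg_left h5 (by positivity)
        linarith
      have hsplit : ∀ ω, (N (k + 1)).sup' (hNne (k + 1)) (fun A => Y A ω) ≤
          (N k).sup' (hNne k) (fun A => Y A ω) +
          (N (k + 1)).sup' (hNne (k + 1)) (fun A => Y A ω - Y (pr A) ω) := by
        intro ω
        refine Finset.sup'_le _ _ fun A hA => ?_
        have h1 := Finset.le_sup' (fun A => Y A ω) (hpr A (hNF _ hA))
        have h2 := Finset.le_sup' (fun A => Y A ω - Y (pr A) ω) hA
        linarith
      have hsum : ∑ ω, w ω * (N (k + 1)).sup' (hNne (k + 1)) (fun A => Y A ω) ≤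
          ∑ ω, w ω * (N k).sup' (hNne k) (fun A => Y A ω) +
          ∑ ω, w ω * (N (k + 1)).sup' (hNne (k + 1)) (fun A => Y A ω - Y (pr A) ω) := by
        rw [← Finset.sum_add_distrib]
        refine Finset.sum_le_sum fun ω _ => ?_
        rw [← mul_add]
        exact mul_le_mul_of_nonneg_left (hsplit ω) (hw ω)
      have hstep : Real.log (N (k + 1)).card / (d / S * 2 ^ k) +
          d / S * 2 ^ k * (v * ((1 / 4) ^ k * n)) / 2 ≤ S * ((1 / 2) ^ k * (4 * k + 11)) := by
        have h1 : Real.log (N (k + 1)).card / (d / S * 2 ^ k) ≤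
            S * ((1 / 2) ^ k * (4 * k + 10)) := by
          refine (div_le_div_of_nonneg_right hlog hθ.le).trans (le_of_eq ?_)
          rw [one_div, inv_pow]
          field_simp
          ring
        have h2 : d / S * 2 ^ k * (v * ((1 / 4) ^ k * n)) / 2 = S * ((1 / 2) ^ k * (1 / 2)) := by
          have h3 : (1 / 4 : ℝ) ^ k = (1 / 2) ^ k * (1 / 2) ^ k := by
            rw [← mul_pow]; norm_num
          have h4 : (2 : ℝ) ^ k * (1 / 2) ^ k = 1 := by rw [← mul_pow]; norm_num
          calc _ = (v * n * d) / S * (2 ^ k * (1 / 2) ^ k) * ((1 / 2) ^ k * (1 / 2)) := by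
                rw [h3]; ring
            _ = _ := by rw [← hS2, h4]; field_simp
        have h5 : 0 < S * (1 / 2 : ℝ) ^ k := by positivity
        rw [h2]
        nlinarith
      have hstep' := mul_le_mul_of_nonneg_left hstep hW
      refine (hsum.trans (add_le_add ih (hmax.trans hstep'))).trans (le_of_eq ?_)
      push_cast
      rw [pow_succ]
      ring
  have hFN : F ⊆ N n := fun A hA => by
    obtain ⟨B, hB, hAB⟩ := hnet n A hA
    have h1 : ((1 / 4 : ℝ)) ^ n * n < 1 := by
      rw [one_div, inv_pow, inv_mul_lt_iff₀ (by positivity), mul_one]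
      exact_mod_cast Nat.lt_pow_self (by norm_num)
    have h2 : (symmDiff A B).card < 1 := by exact_mod_cast hAB.trans_lt h1
    have h3 : symmDiff A B = ∅ := Finset.card_eq_zero.1 (by omega)
    have : A = B := symmDiff_eq_bot.1 h3
    rwa [this]
  calc ∑ ω, w ω * F.sup' hF (fun A => Y A ω)
      ≤ ∑ ω, w ω * (N n).sup' (hNne n) (fun A => Y A ω) :=
        Finset.sum_le_sum fun ω _ => mul_le_mul_of_nonneg_left
          (Finset.sup'_mono _ hFN hF) (hw ω)
    _ ≤ _ := hE n
    _ ≤ _ := by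
        refine mul_le_mul_of_nonneg_left ?_ hW
        have : 0 ≤ S * ((1 / 2) ^ n * (8 * n + 30)) := by positivity
        linarith

/-- Select `y i` where `τ i` holds and `x i` elsewhere. -/
def boolMix {X : Type*} {m : ℕ} (τ : Fin m → Bool) (x y : Fin m → X) (i : Fin m) : X :=
  if τ i then y i else x i

theorem boolMix_boolMix {X : Type*} {m : ℕ} (τ : Fin m → Bool) (x y : Fin m → X) :
    boolMix τ (boolMix τ x y) (boolMix τ y x) = x := by
  funext i
  unfold boolMix
  split_ifs <;> rfl

theorem boolMix_not {X : Type*} {m : ℕ} (τ : Fin m → Bool) (x y : Fin m → X) :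
    boolMix (fun i => !τ i) x y = boolMix τ y x := by
  funext i
  cases h : τ i <;> simp [boolMix, h]

theorem boolMix_update {X : Type*} {m : ℕ} (τ : Fin m → Bool) (x y : Fin m → X) (i : Fin m)
    (b : Bool) : boolMix (Function.update τ i b) x y =
      Function.update (boolMix τ x y) i (if b then y i else x i) := by
  funext k
  by_cases h : k = i
  · subst h; simp [boolMix]
  · simp [boolMix, h]

/-- Exchanging the coordinates selected by `τ` between two configurations. -/
def swapEquiv {X : Type*} {m : ℕ} (τ : Fin m → Bool) :
    (Fin m → X) × (Fin m → X) ≃ (Fin m → X) × (Fin m → X) where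
  toFun q := (boolMix τ q.1 q.2, boolMix τ q.2 q.1)
  invFun q := (boolMix τ q.1 q.2, boolMix τ q.2 q.1)
  left_inv q := by simp [boolMix_boolMix]
  right_inv q := by simp [boolMix_boolMix]

theorem sum_boolMix {X : Type*} [Fintype X] {m : ℕ} (τ : Fin m → Bool)
    (G : (Fin m → X) → (Fin m → X) → ℝ) :
    ∑ x, ∑ y, G (boolMix τ x y) (boolMix τ y x) = ∑ x, ∑ y, G x y := by
  rw [← Fintype.sum_prod_type', ← Fintype.sum_prod_type']
  exact Fintype.sum_equiv (swapEquiv τ) _ _ fun q => rfl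

theorem sum_sum_boolMix {X : Type*} [Fintype X] {m : ℕ}
    (G : (Fin m → X) → (Fin m → X) → ℝ) :
    ∑ x, ∑ y, ∑ τ, G (boolMix τ x y) (boolMix τ y x) = 2 ^ m * ∑ x, ∑ y, G x y := by
  have h : ∑ x, ∑ y, ∑ τ, G (boolMix τ x y) (boolMix τ y x) =
      ∑ τ, ∑ x, ∑ y, G (boolMix τ x y) (boolMix τ y x) := by
    exact (Finset.sum_congr rfl fun x _ => Finset.sum_comm).trans Finset.sum_comm
  rw [h, Finset.sum_congr rfl fun τ _ => sum_boolMix τ G]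
  simp

theorem LogInfluenceLe.boolMix {X : Type*} {m : ℕ} {p : (Fin m → X) → ℝ}
    {C : Fin m → Fin m → ℝ} (hp : ∀ z, 0 < p z) (h : LogInfluenceLe p C) (x y : Fin m → X) :
    LogInfluenceLe (fun τ => p (_root_.boolMix τ x y) * p (_root_.boolMix τ y x))
      (fun i j => 2 * C i j) := by
  intro i j hij τ a a' b b'
  simp only [boolMix_update]
  have h1 := h i j hij (_root_.boolMix τ x y) (if a then y i else x i) (if a' then y i else x i)
    (if b then y j else x j) (if b' then y j else x j)
  have h2 := h i j hij (_root_.boolMix τ y x) (if a then x i else y i) (if a' then x i else y i)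
    (if b then x j else y j) (if b' then x j else y j)
  have h3 := mul_le_mul h1 h2 (mul_pos (hp _) (hp _)).le
    (mul_nonneg (Real.exp_pos _).le (mul_pos (hp _) (hp _)).le)
  have h4 : Real.exp (4 * (2 * C i j)) = Real.exp (4 * C i j) * Real.exp (4 * C i j) := by
    rw [← Real.exp_add]; ring_nf
  rw [h4]
  refine le_of_eq_of_le ?_ (h3.trans (le_of_eq ?_)) <;> ring

/-- The difference of the numbers of points of `A` in the two halves of the double sample
exchanged according to `τ`. -/
def swapDiff {m : ℕ} (A : Finset (Fin m × Bool)) (τ : Fin m → Bool) : ℝ :=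
  ∑ i, ((if (i, τ i) ∈ A then 1 else 0) - (if (i, !τ i) ∈ A then 1 else 0))

theorem swapDiff_not {m : ℕ} (A : Finset (Fin m × Bool)) (τ : Fin m → Bool) :
    swapDiff A (fun i => !τ i) = -swapDiff A τ := by
  rw [swapDiff, swapDiff, ← Finset.sum_neg_distrib]
  refine Finset.sum_congr rfl fun i _ => ?_
  simp

theorem abs_swapDiff_sub_le {m : ℕ} (A B : Finset (Fin m × Bool)) (i : Fin m)
    (τ : Fin m → Bool) (b : Bool) :
    |(swapDiff A τ - swapDiff B τ) -
      (swapDiff A (Function.update τ i b) - swapDiff B (Function.update τ i b))| ≤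
      if i ∈ (symmDiff A B).image Prod.fst then 4 else 0 := by
  simp only [swapDiff]
  rw [← Finset.sum_sub_distrib, ← Finset.sum_sub_distrib, ← Finset.sum_sub_distrib,
    Finset.sum_eq_single i (fun k _ hk => by simp [hk]) (by simp), Function.update_self]
  by_cases hi : i ∈ (symmDiff A B).image Prod.fst
  · rw [if_pos hi]
    have key : ∀ (P : Prop) [Decidable P], |(if P then (1 : ℝ) else 0) - 1 / 2| ≤ 1 / 2 := by
      intro P _
      split_ifs <;> norm_num [abs_le]
    have h1 := key ((i, τ i) ∈ A)
    have h2 := key ((i, !τ i) ∈ A)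
    have h3 := key ((i, τ i) ∈ B)
    have h4 := key ((i, !τ i) ∈ B)
    have h5 := key ((i, b) ∈ A)
    have h6 := key ((i, !b) ∈ A)
    have h7 := key ((i, b) ∈ B)
    have h8 := key ((i, !b) ∈ B)
    rw [abs_le] at h1 h2 h3 h4 h5 h6 h7 h8 ⊢
    constructor <;> linarith [h1.1, h1.2, h2.1, h2.2, h3.1, h3.2, h4.1, h4.2, h5.1, h5.2,
      h6.1, h6.2, h7.1, h7.2, h8.1, h8.2]
  · rw [if_neg hi]
    have h : ∀ b', (i, b') ∈ A ↔ (i, b') ∈ B := by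
      intro b'
      by_contra hne
      refine hi (Finset.mem_image.2 ⟨(i, b'), ?_, rfl⟩)
      rw [Finset.mem_symmDiff]
      tauto
    simp [h]

/-- The trace of `c` on the double sample. -/
def doubleTrace {X : Type*} {m : ℕ} (x y : Fin m → X) (c : X → Bool) : Finset (Fin m × Bool) :=
  Finset.univ.filter fun q => c (if q.2 then y q.1 else x q.1) = true

theorem vcDim_image_doubleTrace_le {X : Type*} {m : ℕ} [DecidableEq X] (x y : Fin m → X)
    (F : Finset (X → Bool)) {d : ℕ} {𝒜 : Finset (Finset X)} (hd : 𝒜.vcDim ≤ d)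
    (hF : ∀ c ∈ F, ∃ A ∈ 𝒜, ∀ a, a ∈ A ↔ c a = true) :
    (F.image (doubleTrace x y)).vcDim ≤ d := by
  refine le_trans ?_ ((vcDim_image_preimage_le 𝒜
    (fun q : Fin m × Bool => if q.2 then y q.1 else x q.1)).trans hd)
  refine Finset.vcDim_mono fun B hB => ?_
  obtain ⟨c, hc, rfl⟩ := Finset.mem_image.1 hB
  obtain ⟨A, hA, hAc⟩ := hF c hc
  refine Finset.mem_image.2 ⟨A, hA, ?_⟩
  ext q
  simp [doubleTrace, hAc]

theorem swapDiff_doubleTrace {X : Type*} {m : ℕ} (x y : Fin m → X) (c : X → Bool)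
    (τ : Fin m → Bool) : swapDiff (doubleTrace x y c) τ =
      ∑ i, ((if c (boolMix τ x y i) then (1 : ℝ) else 0) -
        (if c (boolMix τ y x i) then 1 else 0)) := by
  refine Finset.sum_congr rfl fun i _ => ?_
  cases hτ : τ i <;> simp [doubleTrace, boolMix, hτ]

theorem sum_boolMix_sup_le {X : Type*} [Fintype X] {m : ℕ} {p : (Fin m → X) → ℝ}
    {C : Fin m → Fin m → ℝ} (hp : ∀ z, 0 < p z) (h : LogInfluenceLe p C) {α : ℝ}
    (hα : ∀ j, ∑ i ∈ Finset.univ.erase j, C i j ≤ α) (hα0 : 0 ≤ α) (hα1 : α < 1 / 2)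
    (F : Finset (X → Bool)) (hF : F.Nonempty) {d : ℕ}
    (hd : (F.image fun c => Finset.univ.filter fun a => c a = true).vcDim ≤ d)
    (x y : Fin m → X) :
    ∑ τ, p (boolMix τ x y) * p (boolMix τ y x) *
        F.sup' hF (fun c => ∑ i, ((if c (boolMix τ x y i) then (1 : ℝ) else 0) -
          (if c (boolMix τ y x i) then 1 else 0))) ≤
      (∑ τ, p (boolMix τ x y) * p (boolMix τ y x)) *
        (30 * √(16 / (1 - 2 * α) * (2 * m) * d)) := by
  have hw : ∀ τ : Fin m → Bool, 0 < p (boolMix τ x y) * p (boolMix τ y x) :=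
    fun τ => mul_pos (hp _) (hp _)
  have hα' : ∀ j, ∑ i ∈ Finset.univ.erase j, 2 * C i j ≤ 2 * α := fun j => by
    rw [← Finset.mul_sum]; linarith [hα j]
  have h0 : ∀ A, ∑ τ, p (boolMix τ x y) * p (boolMix τ y x) * swapDiff A τ = 0 := by
    intro A
    have h1 : ∑ τ, p (boolMix τ x y) * p (boolMix τ y x) * swapDiff A τ =
        ∑ τ, -(p (boolMix τ x y) * p (boolMix τ y x) * swapDiff A τ) := by
      refine Fintype.sum_equiv ⟨fun τ i => !τ i, fun τ i => !τ i, fun τ => by simp,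
        fun τ => by simp⟩ _ _ fun τ => ?_
      simp only [Equiv.coe_fn_mk, boolMix_not, swapDiff_not]
      ring
    rw [Finset.sum_neg_distrib] at h1
    linarith
  have hv : 0 < 16 / (1 - 2 * α) := div_pos (by norm_num) (by linarith)
  have hchain := sum_mul_sup_le_of_vcDim_le (F.image (doubleTrace x y))
    (hF.image _) (vcDim_image_doubleTrace_le x y F hd fun c hc =>
      ⟨_, Finset.mem_image_of_mem _ hc, fun a => by simp⟩)
    (fun τ => (hw τ).le) swapDiff hv (fun A _ B _ θ hθ => by
      refine (sum_exp_le hw (h.boolMix hp x y) hα' (by linarith) (by linarith)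
        (c := 4) (by norm_num) ((symmDiff A B).image Prod.fst)
        (fun i τ b => abs_swapDiff_sub_le A B i τ b) (by
          simp only [mul_sub, Finset.sum_sub_distrib, h0, sub_zero]) hθ).trans ?_
      refine mul_le_mul_of_nonneg_left (Real.exp_le_exp.2 ?_)
        (Finset.sum_nonneg fun τ _ => (hw τ).le)
      have h2 : (((symmDiff A B).image Prod.fst).card : ℝ) ≤ (symmDiff A B).card := by
        exact_mod_cast Finset.card_image_le
      have h3 : 0 < 1 - 2 * α := by linarith
      have h4 : (4 : ℝ) ^ 2 * ((symmDiff A B).image Prod.fst).card / (1 - 2 * α) ≤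
          16 / (1 - 2 * α) * (symmDiff A B).card := by
        rw [div_mul_eq_mul_div]
        gcongr
        norm_num
      have h5 : 0 ≤ θ ^ 2 := sq_nonneg θ
      nlinarith) (fun A _ => h0 A)
  refine le_trans (le_of_eq ?_) (hchain.trans (le_of_eq ?_))
  · refine Finset.sum_congr rfl fun τ _ => ?_
    congr 1
    rw [Finset.sup'_image]
    exact Finset.sup'_congr hF rfl fun c _ => (swapDiff_doubleTrace x y c τ).symm
  · simp only [Fintype.card_prod, Fintype.card_fin, Fintype.card_bool]
    push_cast
    ring_nf

theorem sum_apply_eq {X : Type*} [Fintype X] {m : ℕ} {p : (Fin m → X) → ℝ} {D : X → ℝ}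
    (hmarg : ∀ (i : Fin m) (x : X), (∑ z, if z i = x then p z else 0) = D x) (i : Fin m)
    (g : X → ℝ) : ∑ z, p z * g (z i) = ∑ x, D x * g x := by
  simp only [← hmarg i, Finset.sum_mul]
  rw [Finset.sum_comm]
  refine Finset.sum_congr rfl fun z _ => ?_
  simp [ite_mul]

theorem sum_count_eq {X : Type*} [Fintype X] {m : ℕ} {p : (Fin m → X) → ℝ} {D : X → ℝ}
    (hmarg : ∀ (i : Fin m) (x : X), (∑ z, if z i = x then p z else 0) = D x)
    (c : X → Bool) : ∑ z, p z * ∑ i, (if c (z i) then (1 : ℝ) else 0) =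
      m * ∑ x, if c x then D x else 0 := by
  simp only [Finset.mul_sum]
  rw [Finset.sum_comm]
  rw [Finset.sum_congr rfl fun i _ =>
    sum_apply_eq hmarg i (fun x => if c x then (1 : ℝ) else 0)]
  simp [Finset.mul_sum]

/-- Expected uniform deviation for weakly dependent samples. -/
theorem sum_mul_sup_deviation_le {X : Type*} [Fintype X] {m : ℕ} {p : (Fin m → X) → ℝ}
    {C : Fin m → Fin m → ℝ} (hp : ∀ z, 0 < p z) (hp1 : ∑ z, p z = 1) {D : X → ℝ}
    (hmarg : ∀ (i : Fin m) (x : X), (∑ z, if z i = x then p z else 0) = D x)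
    (h : LogInfluenceLe p C) {α : ℝ}
    (hα : ∀ j, ∑ i ∈ Finset.univ.erase j, C i j ≤ α) (hα0 : 0 ≤ α) (hα1 : α < 1 / 2)
    (F : Finset (X → Bool)) (hF : F.Nonempty) {d : ℕ}
    (hd : (F.image fun c => Finset.univ.filter fun a => c a = true).vcDim ≤ d) :
    ∑ x, p x * F.sup' hF (fun c => ∑ i, (if c (x i) then (1 : ℝ) else 0) -
        m * ∑ a, if c a then D a else 0) ≤
      30 * √(16 / (1 - 2 * α) * (2 * m) * d) := by
  set B := 30 * √(16 / (1 - 2 * α) * (2 * m) * d)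
  set Φ : (Fin m → X) → (Fin m → X) → ℝ := fun x y =>
    F.sup' hF (fun c => ∑ i, ((if c (x i) then (1 : ℝ) else 0) -
      (if c (y i) then 1 else 0))) with hΦ
  have h1 : ∀ x, F.sup' hF (fun c => ∑ i, (if c (x i) then (1 : ℝ) else 0) -
        m * ∑ a, if c a then D a else 0) ≤ ∑ y, p y * Φ x y := by
    intro x
    refine Finset.sup'_le _ _ fun c hc => ?_
    calc _ = ∑ y, p y * ∑ i, ((if c (x i) then (1 : ℝ) else 0) -
        (if c (y i) then 1 else 0)) := by
          simp only [Finset.sum_sub_distrib, mul_sub]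
          rw [sum_count_eq hmarg, ← Finset.sum_mul, hp1, one_mul]
      _ ≤ _ := Finset.sum_le_sum fun y _ => mul_le_mul_of_nonneg_left
          (Finset.le_sup' (fun c => ∑ i, ((if c (x i) then (1 : ℝ) else 0) -
            (if c (y i) then 1 else 0))) hc) (hp y).le
  have h2 : ∑ x, p x * F.sup' hF (fun c => ∑ i, (if c (x i) then (1 : ℝ) else 0) -
        m * ∑ a, if c a then D a else 0) ≤ ∑ x, ∑ y, p x * p y * Φ x y := by
    refine Finset.sum_le_sum fun x _ => ?_
    refine (mul_le_mul_of_nonneg_left (h1 x) (hp x).le).trans (le_of_eq ?_)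
    rw [Finset.mul_sum]
    exact Finset.sum_congr rfl fun y _ => by ring
  have h3 : (2 : ℝ) ^ m * ∑ x, ∑ y, p x * p y * Φ x y ≤
      2 ^ m * ∑ x, ∑ y, p x * p y * B := by
    rw [← sum_sum_boolMix fun x y => p x * p y * Φ x y,
      ← sum_sum_boolMix fun x y => p x * p y * B]
    refine Finset.sum_le_sum fun x _ => Finset.sum_le_sum fun y _ => ?_
    rw [← Finset.sum_mul]
    exact sum_boolMix_sup_le hp h hα hα0 hα1 F hF hd x y
  have h4 : ∑ x, ∑ y, p x * p y * B = B := by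
    simp only [← Finset.sum_mul, ← Finset.mul_sum, hp1, mul_one, one_mul]
  rw [h4] at h3
  exact h2.trans (le_of_mul_le_mul_left h3 (by positivity))

theorem tail_le {Z : Type*} [Fintype Z] {m : ℕ} (hm : 0 < m) {p : (Fin m → Z) → ℝ}
    {C : Fin m → Fin m → ℝ} (hp : ∀ z, 0 < p z) (hp1 : ∑ z, p z = 1)
    (h : LogInfluenceLe p C) {α : ℝ}
    (hα : ∀ j, ∑ i ∈ Finset.univ.erase j, C i j ≤ α) (hα0 : 0 ≤ α) (hα1 : α < 1)
    {f : (Fin m → Z) → ℝ} (hf : OscLe f 1) {s : ℝ} (hs : 0 ≤ s) :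
    (∑ x, if ∑ z, p z * f z + s ≤ f x then p x else 0) ≤
      Real.exp (-(s ^ 2 * (1 - α) / (2 * m))) := by
  have hm' : (0 : ℝ) < m := by exact_mod_cast hm
  set E := ∑ z, p z * f z with hE
  have hα' : 0 < 1 - α := by linarith
  have hmgf := sum_exp_le hp h hα hα0 hα1 zero_le_one Finset.univ
    (f := fun x => f x - E) (fun i x b => by simpa using hf i x b)
    (by simp only [mul_sub, Finset.sum_sub_distrib, ← Finset.sum_mul, hp1, one_mul]
        exact sub_self _)
    (θ := s * (1 - α) / m) (by positivity)
  rw [hp1, one_mul, Finset.card_univ, Fintype.card_fin] at hmgf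
  have h1 : (∑ x, if E + s ≤ f x then p x else 0) ≤
      Real.exp (-(s * (1 - α) / m * s)) * ∑ x, p x * Real.exp (s * (1 - α) / m * (f x - E)) := by
    rw [Finset.mul_sum]
    refine Finset.sum_le_sum fun x _ => ?_
    have hpx := hp x
    split_ifs with hx
    · have h2 : 1 ≤ Real.exp (-(s * (1 - α) / m * s)) * Real.exp (s * (1 - α) / m * (f x - E)) := by
        rw [← Real.exp_add, Real.one_le_exp_iff]
        have : 0 ≤ s * (1 - α) / m * ((f x - E) - s) :=
          mul_nonneg (by positivity) (by linarith)
        linarith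
      nlinarith
    · positivity
  refine (h1.trans (mul_le_mul_of_nonneg_left hmgf (Real.exp_pos _).le)).trans (le_of_eq ?_)
  rw [← Real.exp_add]
  congr 1
  field_simp
  ring

theorem oscLe_count {X : Type*} {m : ℕ} (c : X → Bool) :
    OscLe (fun x : Fin m → X => ∑ i, if c (x i) then (1 : ℝ) else 0) 1 := by
  intro i x b
  rw [← Finset.sum_sub_distrib,
    Finset.sum_eq_single i (fun k _ hk => by simp [hk]) (by simp), Function.update_self]
  split_ifs <;> norm_num

theorem OscLe.sup' {Z I : Type*} {m : ℕ} {F : Finset I} (hF : F.Nonempty)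
    {f : I → (Fin m → Z) → ℝ} {c : ℝ} (hf : ∀ k, OscLe (f k) c) :
    OscLe (fun x => F.sup' hF fun k => f k x) c := by
  intro i x b
  have key : ∀ y z : Fin m → Z, (∀ k, f k y ≤ f k z + c) →
      (F.sup' hF fun k => f k y) ≤ (F.sup' hF fun k => f k z) + c := fun y z hyz =>
    Finset.sup'_le _ _ fun k hk =>
      (hyz k).trans (add_le_add_left (Finset.le_sup' (fun k => f k z) hk) c)
  have h1 := key x (Function.update x i b) fun k => by
    have := (abs_le.1 (hf k i x b)).2; linarith
  have h2 := key (Function.update x i b) x fun k => by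
    have := (abs_le.1 (hf k i x b)).1; linarith
  rw [abs_le]
  constructor <;> linarith

/-- With weakly dependent samples, no empirical frequency exceeds its expectation by `ε`, and
the frequency of `c₀` does not fall short of it by `ε`, except with small probability. -/
theorem sum_bad_sample_le {X : Type*} [Fintype X] {m : ℕ} (hm : 0 < m) {p : (Fin m → X) → ℝ}
    {C : Fin m → Fin m → ℝ} (hp : ∀ z, 0 < p z) (hp1 : ∑ z, p z = 1) {D : X → ℝ}
    (hmarg : ∀ (i : Fin m) (x : X), (∑ z, if z i = x then p z else 0) = D x)
    (h : LogInfluenceLe p C) {α : ℝ}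
    (hα : ∀ j, ∑ i ∈ Finset.univ.erase j, C i j ≤ α) (hα0 : 0 ≤ α) (hα1 : α < 1 / 2)
    (F : Finset (X → Bool)) (hF : F.Nonempty) (c₀ : X → Bool) {d : ℕ}
    (hd : (F.image fun c => Finset.univ.filter fun a => c a = true).vcDim ≤ d)
    {ε δ : ℝ} (hε : 0 < ε) (hδ : 0 < δ) (hδ1 : δ < 1)
    (h1 : 16 * Real.log (2 / δ) / ((1 - α) * ε ^ 2) ≤ m)
    (h2 : 115200 * d / ((1 - 2 * α) * ε ^ 2) ≤ m) :
    (∑ x, if (∃ c ∈ F, (m : ℝ) * (∑ a, if c a then D a else 0) + m * ε <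
          ∑ i, if c (x i) then (1 : ℝ) else 0) ∨
        (∑ i, if c₀ (x i) then (1 : ℝ) else 0) + m * ε < m * ∑ a, if c₀ a then D a else 0
      then p x else 0) ≤ δ / 2 := by
  have hm' : (0 : ℝ) < m := by exact_mod_cast hm
  have hα' : 0 < 1 - α := by linarith
  have hα2 : 0 < 1 - 2 * α := by linarith
  set Ψ : (Fin m → X) → ℝ := fun x => F.sup' hF fun c =>
    ∑ i, (if c (x i) then (1 : ℝ) else 0) - m * ∑ a, if c a then D a else 0 with hΨ
  have hEΨ : ∑ x, p x * Ψ x ≤ m * ε / 2 := by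
    refine (sum_mul_sup_deviation_le hp hp1 hmarg h hα hα0 hα1 F hF hd).trans ?_
    have h3 : √(16 / (1 - 2 * α) * (2 * m) * d) ≤ m * ε / 60 := by
      rw [Real.sqrt_le_left (by positivity)]
      rw [div_le_iff₀ (by positivity)] at h2
      have h4 : 16 / (1 - 2 * α) * (2 * m) * d = m * (115200 * d) / (3600 * (1 - 2 * α)) := by
        field_simp
        ring
      rw [h4, div_le_iff₀ (by positivity)]
      have := mul_le_mul_of_nonneg_left h2 hm'.le
      linarith
    linarith
  have hexp : ∀ s : ℝ, m * ε / 2 ≤ s → Real.exp (-(s ^ 2 * (1 - α) / (2 * m))) ≤ δ / 4 := by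
    intro s hs
    have h3 : 2 * Real.log (2 / δ) ≤ s ^ 2 * (1 - α) / (2 * m) := by
      rw [div_le_iff₀ (by positivity)] at h1
      rw [le_div_iff₀ (by positivity)]
      have h5 : (m * ε / 2) ^ 2 ≤ s ^ 2 := pow_le_pow_left₀ (by positivity) hs 2
      have h6 := mul_le_mul_of_nonneg_right h5 hα'.le
      have := mul_le_mul_of_nonneg_left h1 hm'.le
      nlinarith
    calc Real.exp (-(s ^ 2 * (1 - α) / (2 * m))) ≤ Real.exp (-(2 * Real.log (2 / δ))) :=
          Real.exp_le_exp.2 (by linarith)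
      _ = (δ / 2) ^ 2 := by
          have h7 : -(2 * Real.log (2 / δ)) = (2 : ℕ) * Real.log (δ / 2) := by
            rw [← inv_div, Real.log_inv]; push_cast; ring
          rw [h7, Real.exp_nat_mul, Real.exp_log (by positivity)]
      _ ≤ δ / 4 := by nlinarith
  have hoscΨ : OscLe Ψ 1 := OscLe.sup' hF fun c i x b => by
    have := oscLe_count c i x b
    rwa [sub_sub_sub_cancel_right]
  have hosc0 : OscLe (fun x : Fin m → X => -∑ i, if c₀ (x i) then (1 : ℝ) else 0) 1 :=
    fun i x b => by
      have := oscLe_count c₀ i x b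
      rwa [← neg_sub', abs_neg]
  have t1 := (tail_le hm hp hp1 h hα hα0 (by linarith) hoscΨ (s := m * ε / 2)
    (by positivity)).trans (hexp _ le_rfl)
  have t2 := (tail_le hm hp hp1 h hα hα0 (by linarith) hosc0 (s := m * ε)
    (by positivity)).trans (hexp _ (by nlinarith [mul_pos hm' hε]))
  simp only [mul_neg, Finset.sum_neg_distrib, sum_count_eq hmarg] at t2
  refine le_trans ?_ ((add_le_add t1 t2).trans (by linarith))
  rw [← Finset.sum_add_distrib]
  refine Finset.sum_le_sum fun x _ => ?_
  have hpx := (hp x).le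
  have n1 : ∀ (P : Prop) [Decidable P], 0 ≤ if P then p x else 0 := fun P _ => by
    split_ifs <;> simp [hpx]
  by_cases hA : ∃ c ∈ F, (m : ℝ) * (∑ a, if c a then D a else 0) + m * ε <
          ∑ i, if c (x i) then (1 : ℝ) else 0
  · rw [if_pos (Or.inl hA)]
    obtain ⟨c, hc, hlt⟩ := hA
    have h3 := Finset.le_sup' (fun c : X → Bool => ∑ i, (if c (x i) then (1 : ℝ) else 0) -
      (m : ℝ) * ∑ a, if c a then D a else 0) hc
    rw [if_pos (show ∑ z, p z * Ψ z + m * ε / 2 ≤ Ψ x by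
      have : _ ≤ Ψ x := h3
      linarith)]
    exact le_add_of_nonneg_right (n1 _)
  · by_cases hB : (∑ i, if c₀ (x i) then (1 : ℝ) else 0) + m * ε <
        m * ∑ a, if c₀ a then D a else 0
    · rw [if_pos (Or.inr hB)]
      refine le_add_of_nonneg_of_le (n1 _) ?_
      rw [if_pos (by linarith)]
    · rw [if_neg (not_or.2 ⟨hA, hB⟩)]
      exact add_nonneg (n1 _) (n1 _)

/-- The error pattern of `h` with respect to `f` on the sample `x`. -/
def errorPattern {X : Type*} {n : ℕ} (f h : X → Bool) (x : Fin n → X) (i : Fin n) : Bool :=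
  xor (h (x i)) (f (x i))

/-- The pairs of error patterns realised on the samples `x` and `y`. -/
def errorPatterns {X : Type*} {n : ℕ} (H : Set (X → Bool)) (f : X → Bool) (x y : Fin n → X) :
    Finset ((Fin n → Bool) × (Fin n → Bool)) :=
  Finset.univ.filter fun u => ∃ h ∈ H, u = (errorPattern f h x, errorPattern f h y)

/-- The weight of a pair of error patterns: zero unless the first is error free, and otherwise
`2` to the number of errors in the second. -/
def patternWeight {n : ℕ} (u : (Fin n → Bool) × (Fin n → Bool)) : ℝ :=
  ∏ i, if u.1 i then 0 else if u.2 i then 2 else 1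

theorem patternWeight_nonneg {n : ℕ} (u : (Fin n → Bool) × (Fin n → Bool)) :
    0 ≤ patternWeight u :=
  Finset.prod_nonneg fun i _ => by split_ifs <;> norm_num

theorem sum_patternWeight_swap_le {n : ℕ} (u : (Fin n → Bool) × (Fin n → Bool)) :
    ∑ τ, patternWeight (swapEquiv τ u) ≤ 2 ^ n := by
  have h1 : ∑ τ, patternWeight (swapEquiv τ u) = ∏ i, ∑ b : Bool,
      (if (if b then u.2 i else u.1 i) then (0 : ℝ) else
        if (if b then u.1 i else u.2 i) then 2 else 1) :=
    (Fintype.prod_sum fun (i : Fin n) (b : Bool) =>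
      (if (if b then u.2 i else u.1 i) then (0 : ℝ) else
        if (if b then u.1 i else u.2 i) then 2 else 1)).symm
  rw [h1]
  calc _ ≤ ∏ _i : Fin n, (2 : ℝ) := by
        refine Finset.prod_le_prod (fun i _ => Finset.sum_nonneg fun b _ => ?_) fun i _ => ?_
        · split_ifs <;> norm_num
        · rw [Fintype.sum_bool]
          cases u.1 i <;> cases u.2 i <;> norm_num
    _ = 2 ^ n := by simp

theorem errorPattern_boolMix {X : Type*} {n : ℕ} (f h : X → Bool) (τ : Fin n → Bool)
    (x y : Fin n → X) : errorPattern f h (boolMix τ x y) =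
      boolMix τ (errorPattern f h x) (errorPattern f h y) := by
  funext i
  unfold errorPattern boolMix
  split_ifs <;> rfl

theorem sum_errorPatterns_boolMix {X : Type*} {n : ℕ} (H : Set (X → Bool)) (f : X → Bool)
    (τ : Fin n → Bool) (x y : Fin n → X) :
    ∑ u ∈ errorPatterns H f (boolMix τ x y) (boolMix τ y x), patternWeight u =
      ∑ u ∈ errorPatterns H f x y, patternWeight (swapEquiv τ u) := by
  symm
  refine Finset.sum_equiv (swapEquiv τ) (fun u => ?_) fun u _ => rfl
  simp only [errorPatterns, Finset.mem_filter, Finset.mem_univ, true_and, errorPattern_boolMix]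
  have h1 : ∀ h : X → Bool, (boolMix τ (errorPattern f h x) (errorPattern f h y),
      boolMix τ (errorPattern f h y) (errorPattern f h x)) =
        swapEquiv τ (errorPattern f h x, errorPattern f h y) := fun h => rfl
  simp only [h1, (swapEquiv τ).injective.eq_iff]

theorem prod_boolMix_mul {X : Type*} {n : ℕ} (D : X → ℝ) (τ : Fin n → Bool) (x y : Fin n → X) :
    (∏ i, D (boolMix τ x y i)) * ∏ i, D (boolMix τ y x i) = (∏ i, D (x i)) * ∏ i, D (y i) := by
  rw [← Finset.prod_mul_distrib, ← Finset.prod_mul_distrib]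
  refine Finset.prod_congr rfl fun i _ => ?_
  unfold boolMix
  split_ifs
  · exact mul_comm _ _
  · rfl

theorem sum_sum_patternWeight_le {X : Type*} [Fintype X] {n : ℕ} {D : X → ℝ}
    (hD : ∀ x, 0 ≤ D x) (H : Set (X → Bool)) (f : X → Bool) :
    ∑ x : Fin n → X, ∑ y : Fin n → X, (∏ i, D (x i)) * (∏ i, D (y i)) *
        ∑ u ∈ errorPatterns H f x y, patternWeight u ≤
      ∑ x : Fin n → X, ∑ y : Fin n → X, (∏ i, D (x i)) * (∏ i, D (y i)) *
        (errorPatterns H f x y).card := by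
  refine le_of_mul_le_mul_left ?_ (show (0 : ℝ) < 2 ^ n by positivity)
  rw [← sum_sum_boolMix fun x y => (∏ i, D (x i)) * (∏ i, D (y i)) *
    ∑ u ∈ errorPatterns H f x y, patternWeight u, Finset.mul_sum]
  refine Finset.sum_le_sum fun x _ => ?_
  rw [Finset.mul_sum]
  refine Finset.sum_le_sum fun y _ => ?_
  simp only [prod_boolMix_mul, sum_errorPatterns_boolMix]
  rw [← Finset.mul_sum, Finset.sum_comm, mul_left_comm]
  refine mul_le_mul_of_nonneg_left ?_ (mul_nonneg (Finset.prod_nonneg fun i _ => hD _)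
    (Finset.prod_nonneg fun i _ => hD _))
  refine (Finset.sum_le_sum fun u _ => sum_patternWeight_swap_le u).trans (le_of_eq ?_)
  rw [Finset.sum_const, nsmul_eq_mul, mul_comm]

/-- A sample of size `2 * n` as a pair of samples of size `n`. -/
def doubleSampleEquiv (X : Type*) (n : ℕ) : (Fin n → X) × (Fin n → X) ≃ (Fin (2 * n) → X) :=
  (Equiv.sumArrowEquivProdArrow (Fin n) (Fin n) X).symm.trans
    (Equiv.arrowCongr (finSumFinEquiv.trans (finCongr (two_mul n).symm)) (Equiv.refl X))

theorem doubleSampleEquiv_apply {X : Type*} {n : ℕ} (x y : Fin n → X) (k : Fin n ⊕ Fin n) :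
    doubleSampleEquiv X n (x, y) ((finSumFinEquiv.trans (finCongr (two_mul n).symm)) k) =
      Sum.elim x y k := by
  simp only [doubleSampleEquiv, Equiv.trans_apply, Equiv.arrowCongr_apply, Function.comp_apply,
    Equiv.symm_trans_apply, Equiv.symm_apply_apply, Equiv.refl_apply]
  rfl

theorem prod_doubleSampleEquiv {X : Type*} {n : ℕ} (D : X → ℝ) (x y : Fin n → X) :
    ∏ i, D (doubleSampleEquiv X n (x, y) i) = (∏ i, D (x i)) * ∏ i, D (y i) := by
  rw [← (finSumFinEquiv.trans (finCongr (two_mul n).symm)).prod_comp, Fintype.prod_sum_type]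
  simp only [doubleSampleEquiv_apply, Sum.elim_inl, Sum.elim_inr]

theorem card_errorPatterns_le {X : Type*} {n : ℕ} (H : Set (X → Bool)) (f : X → Bool)
    (x y : Fin n → X) : (errorPatterns H f x y).card ≤
      Set.ncard {v : Fin (2 * n) → Bool | ∃ h ∈ H, v = fun i =>
        h (doubleSampleEquiv X n (x, y) i)} := by
  set e := finSumFinEquiv.trans (finCongr (two_mul n).symm)
  set V := {v : Fin (2 * n) → Bool | ∃ h ∈ H, v = fun i => h (doubleSampleEquiv X n (x, y) i)}
  rw [← Set.ncard_coe_finset]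
  refine le_trans (Set.ncard_le_ncard ?_ (Set.toFinite _)) (Set.ncard_image_le (s := V)
    (f := fun v => ((fun i => xor (v (e (Sum.inl i))) (f (x i)),
      fun i => xor (v (e (Sum.inr i))) (f (y i))) : (Fin n → Bool) × (Fin n → Bool)))
    (Set.toFinite _))
  intro u hu
  obtain ⟨h, hh, rfl⟩ := (Finset.mem_filter.1 (Finset.mem_coe.1 hu)).2
  refine ⟨_, ⟨h, hh, rfl⟩, ?_⟩
  simp only [e, doubleSampleEquiv_apply, Sum.elim_inl, Sum.elim_inr]
  rfl

/-- Double-sample bound: the probability that some hypothesis of error more than `ε` is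
consistent with an i.i.d. sample, in terms of the expected number of splits. -/
theorem sum_consistent_mul_le_expectedSplits {X : Type*} [Fintype X] {n : ℕ} {D : X → ℝ}
    (hD : ∀ x, 0 ≤ D x) (hD1 : ∑ x, D x = 1) (H : Set (X → Bool)) (f : X → Bool) {ε : ℝ}
    (hε : 0 ≤ ε) :
    (∑ x : Fin n → X, if ∃ h ∈ H, (∀ i, h (x i) = f (x i)) ∧
        ε < ∑ a, (if h a ≠ f a then D a else 0) then ∏ i, D (x i) else 0) * (1 + ε) ^ n ≤
      expectedSplits D H (2 * n) := by
  have hprod : ∀ x : Fin n → X, 0 ≤ ∏ i, D (x i) := fun x => Finset.prod_nonneg fun i _ => hD _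
  calc _ ≤ ∑ x : Fin n → X, ∑ y : Fin n → X, (∏ i, D (x i)) * (∏ i, D (y i)) *
        ∑ u ∈ errorPatterns H f x y, patternWeight u := by
        rw [Finset.sum_mul]
        refine Finset.sum_le_sum fun x _ => ?_
        split_ifs with hx
        · obtain ⟨h, hh, hcons, herr⟩ := hx
          have h1 : (1 + ε) ^ n ≤ ∑ y : Fin n → X, (∏ i, D (y i)) *
              patternWeight (errorPattern f h x, errorPattern f h y) := by
            have h2 : ∀ y : Fin n → X, (∏ i, D (y i)) *
                patternWeight (errorPattern f h x, errorPattern f h y) =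
                  ∏ i, D (y i) * (if h (y i) ≠ f (y i) then 2 else 1) := by
              intro y
              rw [patternWeight, ← Finset.prod_mul_distrib]
              refine Finset.prod_congr rfl fun i _ => ?_
              simp [errorPattern, hcons i]
            have h3 : ∑ a, D a * (if h a ≠ f a then 2 else 1) =
                1 + ∑ a, if h a ≠ f a then D a else 0 := by
              refine Eq.trans ?_ (congrArg (· + _) hD1)
              rw [← Finset.sum_add_distrib]
              refine Finset.sum_congr rfl fun a _ => ?_
              split_ifs <;> ring
            rw [Finset.sum_congr rfl fun y _ => h2 y,
              ← Fintype.prod_sum fun (_ : Fin n) a => D a * (if h a ≠ f a then (2 : ℝ) else 1), h3,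
              Finset.prod_const, Finset.card_univ, Fintype.card_fin]
            exact pow_le_pow_left₀ (by linarith) (by linarith) n
          refine (mul_le_mul_of_nonneg_left h1 (hprod x)).trans ?_
          rw [Finset.mul_sum]
          refine Finset.sum_le_sum fun y _ => ?_
          rw [mul_assoc]
          refine mul_le_mul_of_nonneg_left (mul_le_mul_of_nonneg_left ?_ (hprod y)) (hprod x)
          exact Finset.single_le_sum (f := patternWeight)
            (fun u _ => patternWeight_nonneg u)
            (show (errorPattern f h x, errorPattern f h y) ∈ errorPatterns H f x y by
              simp only [errorPatterns, Finset.mem_filter, Finset.mem_univ, true_and]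
              exact ⟨h, hh, rfl⟩)
        · rw [zero_mul]
          exact Finset.sum_nonneg fun y _ => mul_nonneg (mul_nonneg (hprod x) (hprod y))
            (Finset.sum_nonneg fun u _ => patternWeight_nonneg u)
    _ ≤ _ := sum_sum_patternWeight_le hD H f
    _ ≤ ∑ x : Fin n → X, ∑ y : Fin n → X, (∏ i, D (doubleSampleEquiv X n (x, y) i)) *
          (Set.ncard {v : Fin (2 * n) → Bool | ∃ h ∈ H, v = fun i =>
            h (doubleSampleEquiv X n (x, y) i)} : ℝ) := by
        refine Finset.sum_le_sum fun x _ => Finset.sum_le_sum fun y _ => ?_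
        rw [prod_doubleSampleEquiv]
        exact mul_le_mul_of_nonneg_left (by exact_mod_cast card_errorPatterns_le H f x y)
          (mul_nonneg (hprod x) (hprod y))
    _ = expectedSplits D H (2 * n) := by
        rw [expectedSplits, ← Fintype.sum_prod_type']
        exact Fintype.sum_equiv (doubleSampleEquiv X n) _ _ fun q => rfl

theorem logInfluenceLe_logInfluence {Z : Type*} [Fintype Z] {m : ℕ} {p : (Fin m → Z) → ℝ}
    (hp : ∀ z, 0 < p z) : LogInfluenceLe p fun i j => logInfluence p j i := by
  intro i j _ x a a' b b'
  have h1 := le_ciSup (f := fun w : (Fin m → Z) × Z × Z × Z × Z =>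
    Real.log (p (updTwo w.1 j w.2.1 i w.2.2.1) * p (updTwo w.1 j w.2.2.2.1 i w.2.2.2.2) /
      (p (updTwo w.1 j w.2.2.2.1 i w.2.2.1) * p (updTwo w.1 j w.2.1 i w.2.2.2.2))))
    (Set.finite_range _).bddAbove (x, b, a, b', a')
  have h2 : 4 * logInfluence p j i = ⨆ w : (Fin m → Z) × Z × Z × Z × Z,
    Real.log (p (updTwo w.1 j w.2.1 i w.2.2.1) * p (updTwo w.1 j w.2.2.2.1 i w.2.2.2.2) /
      (p (updTwo w.1 j w.2.2.2.1 i w.2.2.1) * p (updTwo w.1 j w.2.1 i w.2.2.2.2))) := by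
    rw [logInfluence]; ring
  rw [← h2] at h1
  simp only [updTwo] at h1
  rw [Real.log_le_iff_le_exp (div_pos (mul_pos (hp _) (hp _)) (mul_pos (hp _) (hp _))),
    div_le_iff₀ (mul_pos (hp _) (hp _)), mul_comm (p (Function.update _ i a))
      (p (Function.update (Function.update x j b) i a'))] at h1
  exact h1

theorem sum_logInfluence_le {Z : Type*} [Fintype Z] {m : ℕ} (p : (Fin m → Z) → ℝ) (j : Fin m) :
    ∑ i ∈ Finset.univ.erase j, logInfluence p j i ≤ logCoefficient p :=
  le_ciSup (f := fun j : Fin m => ∑ i ∈ Finset.univ.erase j, logInfluence p j i)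
    (Set.finite_range _).bddAbove j

theorem logCoefficient_nonneg {Z : Type*} [Fintype Z] {m : ℕ} (hm : 0 < m)
    {p : (Fin m → Z) → ℝ} (hp : ∀ z, 0 < p z) (x : Fin m → Z) : 0 ≤ logCoefficient p :=
  (Finset.sum_nonneg fun _ hi => (logInfluenceLe_logInfluence hp).nonneg hp x
    (Finset.ne_of_mem_erase hi)).trans (sum_logInfluence_le p ⟨0, hm⟩)

theorem vcDim_image_le {X : Type*} [Fintype X] (H : Set (X → Bool))
    (chi : (X → Bool) → X → Bool) (F : Finset (X → Bool)) (hF : ∀ c ∈ F, ∃ h ∈ H, chi h = c) :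
    (F.image fun c => Finset.univ.filter fun a => c a = true).vcDim ≤
      vcDim {s : Set X | ∃ h ∈ H, s = {x | chi h x = true}} := by
  refine Finset.sup_le fun s hs => ?_
  rw [Finset.mem_shatterer] at hs
  have hsh : ShattersFamily {s : Set X | ∃ h ∈ H, s = {x | chi h x = true}} s := by
    intro u hu
    obtain ⟨A, hA, hAu⟩ := hs (t := Finset.univ.filter fun a => a ∈ u) fun a ha => by
      simpa using hu (by simpa using ha)
    obtain ⟨c, hc, rfl⟩ := Finset.mem_image.1 hA
    obtain ⟨h, hh, rfl⟩ := hF c hc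
    refine ⟨_, ⟨h, hh, rfl⟩, ?_⟩
    ext a
    have := congrArg (a ∈ ·) hAu
    simp at this
    simp [this]
  have h1 := Finset.le_sup (f := fun F : Finset X => if ShattersFamily
    {s : Set X | ∃ h ∈ H, s = {x | chi h x = true}} F then F.card else 0) (Finset.mem_univ s)
  rw [if_pos hsh] at h1
  exact h1

theorem expectedSplits_nonneg {X : Type*} [Fintype X] {D : X → ℝ} (hD : ∀ x, 0 ≤ D x)
    (H : Set (X → Bool)) (n : ℕ) : 0 ≤ expectedSplits D H n :=
  Finset.sum_nonneg fun _ _ => mul_nonneg (Finset.prod_nonneg fun _ _ => hD _) (Nat.cast_nonneg _)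

theorem exp_half_le_one_add {ε : ℝ} (hε : 0 ≤ ε) (hε1 : ε ≤ 1) : Real.exp (ε / 2) ≤ 1 + ε := by
  have h1 := Real.abs_exp_sub_one_le (x := ε / 2) (by rw [abs_le]; constructor <;> linarith)
  rw [abs_of_nonneg (by linarith : 0 ≤ ε / 2)] at h1
  linarith [(abs_le.1 h1).2]

/-- With enough labeled examples, every hypothesis consistent with them has error at most `ε`,
except with small probability. -/
theorem sum_consistent_le {X : Type*} [Fintype X] {n : ℕ} {D : X → ℝ}
    (hD : ∀ x, 0 ≤ D x) (hD1 : ∑ x, D x = 1) (H : Set (X → Bool)) (f : X → Bool) {ε δ : ℝ}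
    (hε : 0 < ε) (hε1 : ε < 1) (hδ : 0 < δ)
    (hn : (2 / ε) * (Real.log (2 * expectedSplits D H (2 * n)) + Real.log (4 / δ)) ≤ n) :
    (∑ x : Fin n → X, if ∃ h ∈ H, (∀ i, h (x i) = f (x i)) ∧
        ε < ∑ a, (if h a ≠ f a then D a else 0) then ∏ i, D (x i) else 0) ≤ δ / 2 := by
  have h1 := sum_consistent_mul_le_expectedSplits (n := n) hD hD1 H f hε.le
  set P := ∑ x : Fin n → X, if ∃ h ∈ H, (∀ i, h (x i) = f (x i)) ∧
        ε < ∑ a, (if h a ≠ f a then D a else 0) then ∏ i, D (x i) else 0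
  set N := expectedSplits D H (2 * n) with hN
  have hpow : (0 : ℝ) < (1 + ε) ^ n := by positivity
  rcases (expectedSplits_nonneg hD H (2 * n)).eq_or_lt with h0 | h0
  · rw [← hN] at h0
    rw [← h0] at h1
    have : P ≤ 0 := by
      by_contra! hP
      linarith [mul_pos hP hpow]
    linarith
  · rw [← hN] at h0
    have h2 : 8 * N / δ ≤ (1 + ε) ^ n := by
      calc 8 * N / δ = Real.exp (Real.log (2 * N) + Real.log (4 / δ)) := by
            rw [Real.exp_add, Real.exp_log (by positivity), Real.exp_log (by positivity)]
            ring
        _ ≤ Real.exp (n * (ε / 2)) := by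
            rw [div_mul_eq_mul_div, div_le_iff₀ hε] at hn
            exact Real.exp_le_exp.2 (by linarith)
        _ = Real.exp (ε / 2) ^ n := Real.exp_nat_mul _ _
        _ ≤ (1 + ε) ^ n := pow_le_pow_left₀ (Real.exp_pos _).le
            (exp_half_le_one_add hε.le hε1.le) n
    by_contra! hP
    have h3 : δ / 2 * (8 * N / δ) = 4 * N := by field_simp; ring
    have h4 : δ / 2 * (8 * N / δ) ≤ P * (1 + ε) ^ n :=
      mul_le_mul hP.le h2 (by positivity) (by linarith)
    linarith

/-- Union bound over two independent samples. -/
theorem one_sub_le_sum_sum_ite {S T : Type*} [Fintype S] [Fintype T] {p : S → ℝ} {q : T → ℝ}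
    (hp : ∀ s, 0 ≤ p s) (hp1 : ∑ s, p s = 1) (hq : ∀ s, 0 ≤ q s) (hq1 : ∑ s, q s = 1)
    {A : S → Prop} {B : T → Prop} {G : S → T → Prop} {_ : DecidablePred A}
    {_ : DecidablePred B} {_ : ∀ s, DecidablePred (G s)} {a b : ℝ} (hA : ∑ s, (if A s then p s else 0) ≤ a)
    (hB : ∑ s, (if B s then q s else 0) ≤ b) (hG : ∀ s t, ¬ A s → ¬ B t → G s t) :
    1 - (a + b) ≤ ∑ s, ∑ t, if G s t then p s * q t else 0 := by
  have htot : ∑ s, ∑ t, (p s * q t - (if A s then p s else 0) * q t -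
      p s * (if B t then q t else 0)) =
      1 - ∑ s, (if A s then p s else 0) - ∑ t, (if B t then q t else 0) := by
    simp only [Finset.sum_sub_distrib, ← Finset.mul_sum, ← Finset.sum_mul, hq1, hp1, mul_one,
      one_mul]
  refine (by linarith : 1 - (a + b) ≤ _).trans (htot.symm.le.trans ?_)
  refine Finset.sum_le_sum fun s _ => Finset.sum_le_sum fun t _ => ?_
  have h1 := mul_nonneg (hp s) (hq t)
  have h2 := hG s t
  by_cases hs : A s <;> by_cases ht : B t <;> by_cases hg : G s t <;> simp_all

/-- **Sample complexity of semi-supervised learning with weakly dependent unlabeled data.**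
There are universal constants `C₁, C₂ > 0` such that the following holds.  Let `D` be a
distribution on a finite set `X`, let `H` be a class of hypotheses `X → {0,1}` containing the
target `f*`, and let `χ` be a `{0,1}`-valued compatibility function with `χ(f*, D) = 1 − t`
and such that the family `{{x : χ(h,x)=1} : h ∈ H}` has VC dimension `d`.  Suppose the
unlabeled sample `S` of size `m_u` is drawn from a random vector with strictly positive pmf
`p`, coordinate marginals `D`, and log-coefficient `α < 1/2`, and, independently, the labeled
sample of size `m_l` is i.i.d. from `D`, labeled by `f*`.  If
`m_u ≥ max(C₁ log(2/δ)/((1−α)ε²), C₂ d/((1−2α)ε²))` and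
`m_l ≥ (2/ε)(ln(2 H_{D,χ}(t+2ε)[2m_l, D]) + ln(4/δ))`, then with probability at least
`1 − δ`, every maximizer `ĥ` of the empirical compatibility `χ̂(·, S)` over
`H₀ = {h ∈ H : h(x'ᵢ) = f*(x'ᵢ) ∀i}` has true error `err(ĥ) ≤ ε`. -/
theorem fha_sample_complexity :
    ∃ C₁ C₂ : ℝ, 0 < C₁ ∧ 0 < C₂ ∧
      ∀ (X : Type) [Fintype X] [Nonempty X] (D : X → ℝ),
        (∀ x, 0 ≤ D x) → (∑ x, D x = 1) →
        ∀ (H : Set (X → Bool)) (fstar : X → Bool), fstar ∈ H →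
        ∀ (chi : (X → Bool) → X → Bool) (t : ℝ), 0 ≤ t → t ≤ 1 →
          (∑ x, if chi fstar x then D x else 0) = 1 - t →
        ∀ d : ℕ, vcDim {s : Set X | ∃ h ∈ H, s = {x | chi h x = true}} = d →
        ∀ ε δ : ℝ, 0 < ε → ε < 1 → 0 < δ → δ < 1 → t + 2 * ε ≤ 1 →
        ∀ (mu ml : ℕ) (p : (Fin mu → X) → ℝ), (∀ z, 0 < p z) → (∑ z, p z = 1) →
          (∀ (i : Fin mu) (x : X), (∑ z, if z i = x then p z else 0) = D x) →
          logCoefficient p < 1 / 2 →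
          (mu : ℝ) ≥ max (C₁ * Real.log (2 / δ) / ((1 - logCoefficient p) * ε ^ 2))
              (C₂ * d / ((1 - 2 * logCoefficient p) * ε ^ 2)) →
          (ml : ℝ) ≥ (2 / ε) *
              (Real.log (2 * expectedSplits D
                  {h | h ∈ H ∧ 1 - (t + 2 * ε) ≤ ∑ x, if chi h x then D x else 0}
                  (2 * ml)) +
                Real.log (4 / δ)) →
          (∑ s : Fin mu → X, ∑ s' : Fin ml → X,
              if ∀ hhat, (hhat ∈ H ∧ ∀ i, hhat (s' i) = fstar (s' i)) →
                  (∀ h, (h ∈ H ∧ ∀ i, h (s' i) = fstar (s' i)) →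
                    (mu : ℝ)⁻¹ * (∑ i, if chi h (s i) then (1 : ℝ) else 0) ≤
                      (mu : ℝ)⁻¹ * ∑ i, if chi hhat (s i) then (1 : ℝ) else 0) →
                  (∑ x, if hhat x ≠ fstar x then D x else 0) ≤ ε
              then p s * ∏ i, D (s' i) else 0) ≥ 1 - δ := by
  refine ⟨16, 115200, by norm_num, by norm_num, ?_⟩
  intro X _ _ D hD hD1 H fstar hfstar chi t _ _ hchi d hd ε δ hε hε1 hδ hδ1 _ mu ml p hp hp1 hmarg
    hα hmu hml
  set α := logCoefficient p with hαdef
  have hmu1 := (le_max_left _ _).trans hmu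
  have hmu2 := (le_max_right _ _).trans hmu
  have hm : 0 < mu := by
    have h1 : 0 < 16 * Real.log (2 / δ) / ((1 - α) * ε ^ 2) :=
      div_pos (mul_pos (by norm_num) (Real.log_pos (by rw [lt_div_iff₀ hδ]; linarith)))
        (mul_pos (by linarith) (by positivity))
    exact_mod_cast h1.trans_le hmu1
  have hm' : (0 : ℝ) < mu := by exact_mod_cast hm
  obtain ⟨x₀⟩ := ‹Nonempty X›
  set F : Finset (X → Bool) := (Finset.univ.filter fun h => h ∈ H).image chi with hF
  have hmemF : ∀ h ∈ H, chi h ∈ F := fun h hh =>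
    Finset.mem_image_of_mem _ (by simpa using hh)
  have hU := sum_bad_sample_le hm hp hp1 hmarg (logInfluenceLe_logInfluence hp)
    (sum_logInfluence_le p) (logCoefficient_nonneg hm hp fun _ => x₀) hα F
    ⟨_, hmemF fstar hfstar⟩ (chi fstar)
    ((vcDim_image_le H chi F fun c hc => by simpa [hF] using hc).trans hd.le) hε hδ hδ1 hmu1 hmu2
  have hL := sum_consistent_le hD hD1 _ fstar hε hε1 hδ hml
  have hprod1 : ∑ s' : Fin ml → X, ∏ i, D (s' i) = 1 := by
    rw [← Fintype.prod_sum fun (_ : Fin ml) a => D a]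
    simp [hD1]
  refine ge_iff_le.2 (le_trans (by linarith) (one_sub_le_sum_sum_ite (fun s => (hp s).le) hp1
    (fun s' => Finset.prod_nonneg fun i _ => hD _) hprod1 hU hL ?_))
  intro s s' hbU hbL hhat hh hmax
  by_contra! herr
  refine hbL ⟨hhat, ⟨hh.1, ?_⟩, hh.2, herr⟩
  have h1 := le_of_mul_le_mul_left (hmax fstar ⟨hfstar, fun _ => rfl⟩) (inv_pos.2 hm')
  obtain ⟨h2, h3⟩ := not_or.1 hbU
  have h4 := not_lt.1 fun hlt => h2 ⟨chi hhat, hmemF hhat hh.1, hlt⟩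
  rw [not_lt, hchi] at h3
  have h5 : mu * (1 - (t + 2 * ε)) ≤ mu * ∑ x, if chi hhat x then D x else 0 := by linarith
  exact le_of_mul_le_mul_left h5 hm'
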